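/- Let (K, δ) be a differentially closed differential field of characteristic zero. Fix n, h, q ∈ ℕ and polynomials f₁, …, f_s over K in the variables u₁, …, u_q and x_i^{(j)} (1 ≤ i ≤ n, 0 ≤ j ≤ h). For b ∈ K^q, let V_b ⊆ K^{n(h+1)} be the Zariski closed set defined by f₁(b, ·) = ⋯ = f_s(b, ·) = 0 (the coordinates of K^{n(h+1)} being indexed by the pairs (i, j)), and let B_h(V_b) denote the Zariski closure of V_b ∩ ∇_h(K^n) in K^{n(h+1)}. Then the set { b ∈ K^q : V_b = B_h(V_b) } is a differentially constructible subset of K^q. (This is Lemma 2.25 of the paper: prolongation admissibility is definable in families.) -/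

import Mathlib

universe u

/-- `δ` is a derivation: additive and satisfying the Leibniz rule. -/
def IsDerivationFn {R : Type*} [CommRing R] (δ : R → R) : Prop :=
  (∀ a b, δ (a + b) = δ a + δ b) ∧ (∀ a b, δ (a * b) = a * δ b + b * δ a)

/-- Evaluation of a differential polynomial (an ordinary polynomial in the
indeterminates `x_i^{(j)}`, `(i, j) : σ × ℕ`) at a point `a` of a differential
ring extension given by a ring hom `ι` and a derivation `δ` on the target:
`x_i^{(j)}` is sent to `δ^j (a i)`. -/
noncomputable def devalMap {K L : Type*} [CommRing K] [CommRing L] (ι : K →+* L)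
    (δ : L → L) {σ : Type*} (f : MvPolynomial (σ × ℕ) K) (a : σ → L) : L :=
  MvPolynomial.eval₂ ι (fun p => δ^[p.2] (a p.1)) f

/-- `(K, δ)` is a differentially closed field: every finite system of differential
polynomial equations with one inequation which is solvable in some differential
field extension of `K` is already solvable in `K`. -/
def DiffClosedField (K : Type u) [Field K] (δ : K → K) : Prop :=
  IsDerivationFn δ ∧
    ∀ (n r : ℕ) (f : Fin r → MvPolynomial (Fin n × ℕ) K)
      (g : MvPolynomial (Fin n × ℕ) K),
      (∃ (L : Type u) (_ : Field L) (ι : K →+* L) (δL : L → L),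
          IsDerivationFn δL ∧ (∀ x, ι (δ x) = δL (ι x)) ∧
          ∃ b : Fin n → L, (∀ i, devalMap ι δL (f i) b = 0) ∧
            devalMap ι δL g b ≠ 0) →
      ∃ a : Fin n → K, (∀ i, devalMap (RingHom.id K) δ (f i) a = 0) ∧
        devalMap (RingHom.id K) δ g a ≠ 0

/-- The Kolchin topology on `σ → K`: the closed sets are the common zero sets of
sets of differential polynomials over `K`. -/
def kolchinTopology (K : Type*) [Field K] (δ : K → K) (σ : Type*) :
    TopologicalSpace (σ → K) :=
  TopologicalSpace.generateFrom
    {U | ∃ f : MvPolynomial (σ × ℕ) K,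
      U = {a | devalMap (RingHom.id K) δ f a ≠ 0}}

/-- A set is constructible w.r.t. a topology `t` if it is a finite union of
differences of `t`-closed sets (equivalently, a finite Boolean combination of
closed sets). -/
def IsConstructibleIn {α : Type*} (t : TopologicalSpace α) (S : Set α) : Prop :=
  ∃ (r : ℕ) (C D : Fin r → Set α),
    (∀ i, @IsClosed _ t (C i)) ∧ (∀ i, @IsClosed _ t (D i)) ∧
    S = ⋃ i, C i \ D i

/-- The Zariski topology on affine space `σ → K`: the closed sets are the common
zero loci of sets of polynomials over `K`. -/
def zariskiTopology (K : Type*) [CommRing K] (σ : Type*) :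
    TopologicalSpace (σ → K) :=
  TopologicalSpace.generateFrom
    {U | ∃ f : MvPolynomial σ K, U = {x | MvPolynomial.eval x f ≠ 0}}

/-- The prolongation map `∇_h : K^n → K^{n(h+1)}`, `a ↦ (a, δa, …, δ^h a)`,
with `K^{n(h+1)}` indexed by pairs `(i, j) : Fin n × Fin (h+1)`. -/
def nablaMap {K : Type*} (δ : K → K) (n h : ℕ) (a : Fin n → K) :
    Fin n × Fin (h + 1) → K :=
  fun p => δ^[(p.2 : ℕ)] (a p.1)

section

open MvPolynomial TensorProduct

/-- Over a domain, some power of a fixed nonzero `d` multiplies any polynomial into the sum of a given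
ideal and the span of its standard monomials. -/
lemma exists_standard_monomials {R : Type*} [CommRing R] [IsDomain R] {m : ℕ}
    (I : Ideal (MvPolynomial (Fin m) R)) :
    ∃ (S : Set (Fin m →₀ ℕ)) (d : R), d ≠ 0 ∧
      (∀ F ∈ I, F ∈ restrictSupport R S → F = 0) ∧
      ∀ F, ∃ N : ℕ, ∃ G ∈ restrictSupport R S, C d ^ N * F - G ∈ I := by
  classical
  let μ : MonomialOrder (Fin m) := MonomialOrder.lex
  let Λ : Set (Fin m →₀ ℕ) := {a | ∃ g ∈ I, g ≠ 0 ∧ μ.degree g = a}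
  have hfin : {a | Minimal (· ∈ Λ) a}.Finite :=
    WellQuasiOrderedLE.finite_of_isAntichain (setOfPred_minimal_antichain _)
  have hex : ∀ a ∈ Λ, ∃ g ∈ I, g ≠ 0 ∧ μ.degree g = a := fun a ha => ha
  choose! g hgI hg0 hgd using hex
  let d : R := ∏ a ∈ hfin.toFinset, μ.leadingCoeff (g a)
  have hmin : ∀ a ∈ hfin.toFinset, a ∈ Λ := fun a ha => ((hfin.mem_toFinset).1 ha).prop
  refine ⟨Λᶜ, d, ?_, ?_, ?_⟩
  · exact Finset.prod_ne_zero_iff.2 fun a ha => μ.leadingCoeff_ne_zero_iff.2 (hg0 a (hmin a ha))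
  · intro F hF hFS
    by_contra h0
    exact hFS (μ.degree_mem_support h0) ⟨F, hF, h0, rfl⟩
  let W : Set (MvPolynomial (Fin m) R) :=
    {F | ∃ N : ℕ, ∃ G ∈ restrictSupport R Λᶜ, C d ^ N * F - G ∈ I}
  have hsmul : ∀ F ∈ W, ∀ p : R, C p * F ∈ W := by
    rintro F ⟨N, G, hG, h⟩ p
    refine ⟨N, p • G, Submodule.smul_mem _ _ hG, ?_⟩
    have := I.mul_mem_left (C p) h
    rw [smul_eq_C_mul]
    convert this using 1
    ring
  have hadd : ∀ F ∈ W, ∀ F' ∈ W, F + F' ∈ W := by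
    rintro F ⟨N, G, hG, h⟩ F' ⟨N', G', hG', h'⟩
    refine ⟨N + N', (d ^ N') • G + (d ^ N) • G',
      add_mem (Submodule.smul_mem _ _ hG) (Submodule.smul_mem _ _ hG'), ?_⟩
    have := add_mem (I.mul_mem_left (C d ^ N') h) (I.mul_mem_left (C d ^ N) h')
    rw [smul_eq_C_mul, smul_eq_C_mul, C_pow, C_pow]
    convert this using 1
    ring
  have hzero : (0 : MvPolynomial (Fin m) R) ∈ W := ⟨0, 0, zero_mem _, by simp⟩
  have hsum : ∀ F : MvPolynomial (Fin m) R, (∀ c ∈ F.support, monomial c (1 : R) ∈ W) → F ∈ W := by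
    intro F hF
    rw [F.as_sum]
    refine Finset.sum_induction _ (· ∈ W) (fun a b ha hb => hadd a ha b hb) hzero fun c hc => ?_
    have := hsmul _ (hF c hc) (coeff c F)
    rwa [C_mul_monomial, mul_one] at this
  have key : ∀ t : μ.syn, monomial (μ.toSyn.symm t) (1 : R) ∈ W := by
    intro t
    induction t using WellFoundedLT.induction with
    | _ t ih =>
    set c := μ.toSyn.symm t with hc
    by_cases hcΛ : c ∈ Λ
    · obtain ⟨a, hac, ha⟩ := exists_minimal_le_of_wellFoundedLT (· ∈ Λ) c hcΛ
      have ha' : a ∈ hfin.toFinset := hfin.mem_toFinset.2 ha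
      obtain ⟨e, he⟩ : μ.leadingCoeff (g a) ∣ d := Finset.dvd_prod_of_mem _ ha'
      have hga := hgd a ha.prop
      let F := C d * monomial c (1 : R) - monomial (c - a) e * g a
      have hF : F ∈ W := by
        refine hsum F fun b hb => ?_
        have hbc : b ≠ c := by
          intro hbc
          rw [mem_support_iff, hbc] at hb
          apply hb
          have h1 : coeff c (monomial (c - a) e * g a) = e * coeff a (g a) := by
            have := coeff_monomial_mul a (c - a) e (g a)
            rwa [tsub_add_cancel_of_le hac] at this
          simp only [F, coeff_sub, C_mul_monomial, coeff_monomial, if_true, h1]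
          rw [he, MonomialOrder.leadingCoeff, hga]
          ring
        have hble : μ.toSyn b ≤ μ.toSyn c := by
          rcases Finset.mem_union.1 (support_sub _ _ _ hb) with h | h
          · rw [C_mul_monomial] at h
            have := support_monomial_subset h
            rw [Finset.mem_singleton] at this
            rw [this]
          · have := support_mul _ _ h
            obtain ⟨x, hx, y, hy, rfl⟩ := Finset.mem_add.1 this
            have hx' := Finset.mem_singleton.1 (support_monomial_subset hx)
            subst hx'
            have hy' : μ.toSyn y ≤ μ.toSyn a := hga ▸ μ.le_degree hy
            calc μ.toSyn (c - a + y) = μ.toSyn (c - a) + μ.toSyn y := map_add _ _ _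
              _ ≤ μ.toSyn (c - a) + μ.toSyn a := by gcongr
              _ = μ.toSyn (c - a + a) := (map_add _ _ _).symm
              _ = μ.toSyn c := by rw [tsub_add_cancel_of_le hac]
        have hlt : μ.toSyn b < t := by
          have : μ.toSyn c = t := by simp [hc]
          rw [← this]
          exact lt_of_le_of_ne hble fun h => hbc (μ.toSyn.injective h)
        simpa using ih _ hlt
      obtain ⟨N, G, hG, h⟩ := hF
      refine ⟨N + 1, G, hG, ?_⟩
      have h2 := I.mul_mem_left (C d ^ N * monomial (c - a) e) (hgI a ha.prop)
      have := add_mem h h2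
      convert this using 1
      simp only [F]
      ring
    · refine ⟨0, monomial c 1, ?_, by simp⟩
      intro b hb
      have := Finset.mem_singleton.1 (support_monomial_subset hb)
      rwa [this]
  intro F
  exact hsum F fun c _ => by simpa using key (μ.toSyn c)

/-- Generic freeness for algebras of finite type over a domain. -/
lemma generic_freeness (R T : Type*) [CommRing R] [IsDomain R] [CommRing T] [Algebra R T]
    [Algebra.FiniteType R T] :
    ∃ d : R, d ≠ 0 ∧ Module.Free (Localization.Away d) (Localization.Away d ⊗[R] T) := by
  obtain ⟨m, π, hπ⟩ := Algebra.FiniteType.iff_quotient_mvPolynomial''.1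
    (inferInstance : Algebra.FiniteType R T)
  obtain ⟨S, d, hd, hS, hF⟩ := exists_standard_monomials (RingHom.ker π)
  refine ⟨d, hd, ?_⟩
  let β : restrictSupport R S →ₗ[R] T := π.toLinearMap ∘ₗ (restrictSupport R S).subtype
  have hβ : Function.Injective β := by
    rw [← LinearMap.ker_eq_bot, LinearMap.ker_eq_bot']
    rintro ⟨G, hG⟩ h
    exact Subtype.ext (hS G h hG)
  have : Module.Flat R (Localization.Away d) := IsLocalization.flat _ (Submonoid.powers d)
  let β' := β.baseChange (Localization.Away d)
  have hinj : Function.Injective β' :=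
    Module.Flat.lTensor_preserves_injective_linearMap (M := Localization.Away d) β hβ
  have hsurj : Function.Surjective β' := by
    rw [← LinearMap.range_eq_top, eq_top_iff]
    intro z _
    induction z using TensorProduct.induction_on with
    | zero => exact zero_mem _
    | add x y hx hy => exact add_mem (hx trivial) (hy trivial)
    | tmul c t =>
      obtain ⟨F, rfl⟩ := hπ t
      obtain ⟨N, G, hG, h⟩ := hF F
      have hu := (IsLocalization.Away.algebraMap_isUnit (S := Localization.Away d) d).pow N
      obtain ⟨u, hu⟩ := hu
      refine ⟨(c * ↑u⁻¹) ⊗ₜ ⟨G, hG⟩, ?_⟩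
      have h1 : β ⟨G, hG⟩ = d ^ N • π F := by
        have : π (C d ^ N * F - G) = 0 := h
        rw [map_sub, sub_eq_zero, map_mul, map_pow] at this
        change π G = _
        rw [← this, Algebra.smul_def, map_pow]
        congr 2
        exact π.commutes d
      change (c * ↑u⁻¹) ⊗ₜ[R] (β ⟨G, hG⟩) = _
      rw [h1, ← TensorProduct.smul_tmul, Algebra.smul_def, map_pow, ← hu]
      congr 1
      rw [mul_left_comm, Units.mul_inv, mul_one]
  have : Module.Free R (restrictSupport R S) := Module.Free.of_basis (basisRestrictSupport R S)
  exact Module.Free.of_equiv (LinearEquiv.ofBijective β' ⟨hinj, hsurj⟩)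

/-- Weak Nullstellensatz. -/
lemma nonempty_algHom_of_finiteType (k T : Type*) [Field k] [IsAlgClosed k] [CommRing T]
    [Algebra k T] [Algebra.FiniteType k T] [Nontrivial T] : Nonempty (T →ₐ[k] k) := by
  obtain ⟨M, hM⟩ := Ideal.exists_maximal T
  let := Ideal.Quotient.field M
  have : Algebra.FiniteType k (T ⧸ M) :=
    Algebra.FiniteType.of_surjective (Ideal.Quotient.mkₐ k M) (Ideal.Quotient.mkₐ_surjective k M)
  have : Module.Finite k (T ⧸ M) := finite_of_finite_type_of_isJacobsonRing k (T ⧸ M)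
  have hb : Function.Bijective (algebraMap k (T ⧸ M)) :=
    IsAlgClosed.algebraMap_bijective_of_isIntegral
  exact ⟨((AlgEquiv.ofBijective (Algebra.ofId k (T ⧸ M)) hb).symm : (T ⧸ M) →ₐ[k] k).comp
    (Ideal.Quotient.mkₐ k M)⟩

/-- Strong Nullstellensatz: a non-nilpotent element does not vanish at some closed point. -/
lemma exists_algHom_ne_zero (k T : Type*) [Field k] [IsAlgClosed k] [CommRing T]
    [Algebra k T] [Algebra.FiniteType k T] {z : T} (hz : ¬ IsNilpotent z) :
    ∃ χ : T →ₐ[k] k, χ z ≠ 0 := by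
  have : Nontrivial (Localization.Away z) := by
    by_contra h
    rw [not_nontrivial_iff_subsingleton] at h
    obtain ⟨n, hn⟩ := (IsLocalization.subsingleton_iff (S := Localization.Away z)
      (M := Submonoid.powers z)).1 h
    exact hz ⟨n, hn⟩
  have : Algebra.FiniteType T (Localization.Away z) :=
    IsLocalization.finiteType_of_monoid_fg (Submonoid.powers z) _
  have : Algebra.FiniteType k (Localization.Away z) := Algebra.FiniteType.trans (S := T) ‹_› ‹_›
  obtain ⟨χ⟩ := nonempty_algHom_of_finiteType k (Localization.Away z)
  refine ⟨χ.comp (IsScalarTower.toAlgHom k T (Localization.Away z)), ?_⟩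
  exact ((IsLocalization.Away.algebraMap_isUnit (S := Localization.Away z) z).map χ).ne_zero

/-- A non-nilpotent element does not vanish at some geometric point. -/
lemma exists_ringHom_algClosed_ne_zero.{w} {T : Type w} [CommRing T] {z : T} (hz : ¬ IsNilpotent z) :
    ∃ (k : Type w) (_ : Field k) (_ : IsAlgClosed k) (χ : T →+* k), χ z ≠ 0 := by
  have : ∃ P : Ideal T, P.IsPrime ∧ z ∉ P := by
    by_contra! h
    exact hz (by rwa [← mem_nilradical, nilradical_eq_sInf, Ideal.mem_sInf])
  obtain ⟨P, hP, hzP⟩ := this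
  refine ⟨AlgebraicClosure P.ResidueField, inferInstance, inferInstance,
    (algebraMap _ _).comp (algebraMap T P.ResidueField), ?_⟩
  simpa using hzP

/-- A point of a domain `R` outside a suitable hypersurface lifts along an injective finite type
extension. -/
lemma exists_ne_zero_forall_lift.{w} (R T : Type*) [CommRing R] [IsDomain R] [CommRing T]
    [Algebra R T] [Algebra.FiniteType R T] (hinj : Function.Injective (algebraMap R T)) :
    ∃ d : R, d ≠ 0 ∧ ∀ (k : Type w) [Field k] [IsAlgClosed k] (ψ : R →+* k), ψ d ≠ 0 →
      ∃ ψ' : T →+* k, ∀ r, ψ' (algebraMap R T r) = ψ r := by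
  obtain ⟨d, hd, hfree⟩ := generic_freeness R T
  refine ⟨d, hd, fun k _ _ ψ hψ => ?_⟩
  let φ : Localization.Away d →+* k := IsLocalization.Away.lift d (IsUnit.mk0 _ hψ)
  let := φ.toAlgebra
  have hdom : IsDomain (Localization.Away d) :=
    IsLocalization.isDomain_localization (powers_le_nonZeroDivisors_of_noZeroDivisors hd)
  have hflat : Module.Flat R (Localization.Away d) := IsLocalization.flat _ (Submonoid.powers d)
  have hnt : Nontrivial (Localization.Away d ⊗[R] T) := by
    have := Module.Flat.lTensor_preserves_injective_linearMap (M := Localization.Away d)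
      (Algebra.linearMap R T) hinj
    have h2 := this.comp (TensorProduct.rid R (Localization.Away d)).symm.injective
    exact h2.nontrivial
  have hnt' : Nontrivial (k ⊗[Localization.Away d] (Localization.Away d ⊗[R] T)) :=
    Module.FaithfullyFlat.rTensor_nontrivial _ _ _
  obtain ⟨χ⟩ := nonempty_algHom_of_finiteType k
    (k ⊗[Localization.Away d] (Localization.Away d ⊗[R] T))
  let χ' : Localization.Away d ⊗[R] T →ₐ[Localization.Away d] k :=
    (χ.restrictScalars (Localization.Away d)).comp Algebra.TensorProduct.includeRight
  refine ⟨χ'.toRingHom.comp (Algebra.TensorProduct.includeRight (R := R)).toRingHom, fun r => ?_⟩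
  have h1 : (1 : Localization.Away d) ⊗ₜ[R] algebraMap R T r =
      algebraMap (Localization.Away d) _ (algebraMap R (Localization.Away d) r) := by
    rw [Algebra.TensorProduct.algebraMap_apply, Algebra.algebraMap_self_apply,
      Algebra.algebraMap_eq_smul_one r, Algebra.algebraMap_eq_smul_one r, TensorProduct.smul_tmul]
  change χ' ((1 : Localization.Away d) ⊗ₜ[R] algebraMap R T r) = _
  rw [h1, AlgHom.commutes]
  exact IsLocalization.Away.lift_eq d _ r

/-- After inverting a suitable `d`, a non-zero-divisor stays one on all fibres. -/
lemma exists_ne_zero_forall_nonZeroDivisor.{w} (R T : Type*) [CommRing R] [IsDomain R] [CommRing T]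
    [Algebra R T] [Algebra.FiniteType R T] (t : T) (ht : ∀ x, t * x = 0 → x = 0) :
    ∃ d : R, d ≠ 0 ∧ ∀ (k : Type w) [Field k] [Algebra R k], algebraMap R k d ≠ 0 →
      ∀ z : k ⊗[R] T, (1 ⊗ₜ t) * z = 0 → z = 0 := by
  obtain ⟨d, hd, hfree⟩ := generic_freeness R (T ⧸ Ideal.span {t})
  refine ⟨d, hd, fun k _ _ hk => ?_⟩
  let Rd := Localization.Away d
  let φ : Rd →+* k := IsLocalization.Away.lift d (IsUnit.mk0 _ hk)
  let : Algebra Rd k := φ.toAlgebra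
  have : IsScalarTower R Rd k := IsScalarTower.of_algebraMap_eq fun r =>
    (IsLocalization.Away.lift_eq d _ r).symm
  have hflat : Module.Flat R Rd := IsLocalization.flat _ (Submonoid.powers d)
  let μ : T →ₗ[R] T := LinearMap.mulLeft R t
  let π : T →ₗ[R] T ⧸ Ideal.span {t} := (Ideal.Quotient.mkₐ R _).toLinearMap
  have hμ : Function.Injective μ := by
    rw [← LinearMap.ker_eq_bot, LinearMap.ker_eq_bot']
    exact ht
  have hex : Function.Exact μ π := by
    intro x
    change Ideal.Quotient.mk _ x = 0 ↔ _
    rw [Ideal.Quotient.eq_zero_iff_mem, Ideal.mem_span_singleton']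
    simp [μ, mul_comm]
  have hπ : Function.Surjective π := Ideal.Quotient.mk_surjective
  let μ' := μ.baseChange Rd
  let π' := π.baseChange Rd
  have hμ' : Function.Injective μ' :=
    Module.Flat.lTensor_preserves_injective_linearMap (M := Rd) μ hμ
  have hex' : Function.Exact μ' π' := lTensor_exact Rd hex hπ
  have hπ' : Function.Surjective π' := LinearMap.lTensor_surjective Rd hπ
  obtain ⟨l, hl⟩ := Module.projective_lifting_property π' LinearMap.id hπ'
  have hsplit : (Function.Injective μ' ∧ ∃ l, π' ∘ₗ l = LinearMap.id) ↔
      (Function.Surjective π' ∧ ∃ l, l ∘ₗ μ' = LinearMap.id) := hex'.split_tfae'.out 0 1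
  obtain ⟨-, ρ, hρ⟩ := hsplit.1 ⟨hμ', l, hl⟩
  intro z hz
  let e := TensorProduct.AlgebraTensorModule.cancelBaseChange R Rd k k T
  have hcomm : ∀ y, e (μ'.baseChange k y) = (1 ⊗ₜ t) * e y := by
    intro y
    induction y using TensorProduct.induction_on with
    | zero => simp
    | add x y hx hy => rw [map_add, map_add, map_add, hx, hy, mul_add]
    | tmul c y =>
      induction y using TensorProduct.induction_on with
      | zero => simp
      | add x y hx hy => simp only [tmul_add, map_add, hx, hy, mul_add]
      | tmul b y => simp [e, μ', μ]
  have h1 : e (μ'.baseChange k (e.symm z)) = 0 := by rw [hcomm, e.apply_symm_apply, hz]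
  have h2 : μ'.baseChange k (e.symm z) = 0 := e.map_eq_zero_iff.1 h1
  have h3 : (ρ.baseChange k) (μ'.baseChange k (e.symm z)) = e.symm z := by
    rw [← LinearMap.comp_apply, ← LinearMap.baseChange_comp, hρ, LinearMap.baseChange_id]
    rfl
  rw [h2, map_zero] at h3
  rw [← e.apply_symm_apply z, ← h3, map_zero]

/-- After inverting a suitable `d`, torsion dies on all fibres. -/
lemma exists_ne_zero_forall_torsion.{w} (R T : Type*) [CommRing R] [IsDomain R] [CommRing T]
    [Algebra R T] [Algebra.FiniteType R T] :
    ∃ d : R, d ≠ 0 ∧ ∀ (k : Type w) [Field k] (χ : T →+* k), χ (algebraMap R T d) ≠ 0 →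
      ∀ (r : R) (a : T), r ≠ 0 → algebraMap R T r * a = 0 → χ a = 0 := by
  obtain ⟨d, hd, hfree⟩ := generic_freeness R T
  refine ⟨d, hd, fun k _ χ hχ r a hr ha => ?_⟩
  let : Algebra R k := (χ.comp (algebraMap R T)).toAlgebra
  let χ' : T →ₐ[R] k := { χ with commutes' := fun r => rfl }
  let φ : (Localization.Away d) →ₐ[R] k := {
    IsLocalization.Away.lift (S := (Localization.Away d)) (g := algebraMap R k) d
      (IsUnit.mk0 _ hχ) with
    commutes' := fun r => IsLocalization.Away.lift_eq d _ r }
  have hdom : IsDomain (Localization.Away d) :=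
    IsLocalization.isDomain_localization (powers_le_nonZeroDivisors_of_noZeroDivisors hd)
  have hr' : algebraMap R (Localization.Away d) r ≠ 0 := by
    intro h
    exact hr ((IsLocalization.injective (Localization.Away d)
      (powers_le_nonZeroDivisors_of_noZeroDivisors hd)) (by rw [h, map_zero]))
  have h0 : algebraMap R (Localization.Away d) r • ((1 : (Localization.Away d)) ⊗ₜ[R] a) = 0 := by
    rw [algebraMap_smul, ← tmul_smul, Algebra.smul_def, ha, tmul_zero]
  let bs := Module.Free.chooseBasis (Localization.Away d) (Localization.Away d ⊗[R] T)
  have h1 : (1 : (Localization.Away d)) ⊗ₜ[R] a = 0 := by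
    refine bs.ext_elem fun i => ?_
    have h := congrArg (fun y => bs.repr y i) h0
    simp only [map_smul, Finsupp.smul_apply, smul_eq_mul, map_zero, Finsupp.zero_apply] at h
    rw [(mul_eq_zero.1 h).resolve_left hr', map_zero, Finsupp.zero_apply]
  have h2 := congrArg (Algebra.TensorProduct.lift φ χ' fun _ _ => Commute.all _ _) h1
  rw [Algebra.TensorProduct.lift_tmul, map_one, one_mul, map_zero] at h2
  exact h2

/-- `X N` is algebraically independent, modulo the kernel of `π`, of the previous variables. -/
def IsTransAt {R A : Type*} [CommRing R] [CommRing A] (π : MvPolynomial ℕ R →+* A) (N : ℕ) : Prop :=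
  ∀ p : Polynomial (supported R (Set.Iio N)), π (Polynomial.aeval (X N : MvPolynomial ℕ R) p) = 0 →
    ∀ i, π (p.coeff i : MvPolynomial ℕ R) = 0

/-- `D` acts on `MvPolynomial ℕ R` by shifting variables by `m` and preserves the constants. -/
def IsShift {R : Type*} [CommRing R] (D : Derivation ℤ (MvPolynomial ℕ R) (MvPolynomial ℕ R))
    (m : ℕ) : Prop :=
  (∀ r, ∃ r', D (C r) = C r') ∧ ∀ N, D (X N) = X (N + m)

lemma X_mem_supported_Iio {R : Type*} [CommRing R] {i N : ℕ} (h : i < N) :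
    (X i : MvPolynomial ℕ R) ∈ supported R (Set.Iio N) :=
  Algebra.subset_adjoin ⟨i, h, rfl⟩

lemma exists_polynomial_of_mem_supported {R : Type*} [CommRing R] {N : ℕ} {F : MvPolynomial ℕ R}
    (hF : F ∈ supported R (Set.Iio (N + 1))) :
    ∃ p : Polynomial (supported R (Set.Iio N)), Polynomial.aeval (X N : MvPolynomial ℕ R) p = F := by
  have h : Set.Iio (N + 1) = Set.Iio N ∪ {N} := by ext; simp
  rw [h, supported, Set.image_union, Algebra.adjoin_union_eq_adjoin_adjoin, Set.image_singleton] at hF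
  rw [Subalgebra.mem_restrictScalars, Algebra.adjoin_singleton_eq_range_aeval] at hF
  exact hF

lemma aeval_X_mem_supported {R : Type*} [CommRing R] {N : ℕ}
    (p : Polynomial (supported R (Set.Iio N))) :
    Polynomial.aeval (X N : MvPolynomial ℕ R) p ∈ supported R (Set.Iio (N + 1)) := by
  rw [Polynomial.aeval_eq_sum_range]
  refine sum_mem fun i _ => ?_
  rw [Subalgebra.smul_def, smul_eq_mul]
  exact mul_mem (supported_mono (Set.Iio_subset_Iio (Nat.le_succ N)) (p.coeff i).2)
    (pow_mem ((X_mem_supported_Iio (Nat.lt_succ_self N))) i)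

lemma map_aeval_X {R A : Type*} [CommRing R] [CommRing A] (π : MvPolynomial ℕ R →+* A) {N : ℕ}
    (p : Polynomial (supported R (Set.Iio N))) :
    π (Polynomial.aeval (X N : MvPolynomial ℕ R) p) =
      ∑ i ∈ Finset.range (p.natDegree + 1), π (p.coeff i) * π (X N) ^ i := by
  rw [Polynomial.aeval_eq_sum_range, map_sum]
  simp only [Subalgebra.smul_def, smul_eq_mul, map_mul, map_pow]

/-- Pseudo-division by a polynomial which is linear in `X N`. -/
lemma exists_pseudo_remainder {R : Type*} [CommRing R] {N : ℕ} {F σ P : MvPolynomial ℕ R}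
    (hF : F ∈ supported R (Set.Iio (N + 1))) (hσ : σ ∈ supported R (Set.Iio N))
    (hP : P ∈ supported R (Set.Iio N)) :
    ∃ F' ∈ supported R (Set.Iio N), ∃ (e : ℕ) (c : MvPolynomial ℕ R),
      F' = σ ^ e * F + c * (σ * X N - P) := by
  obtain ⟨p, rfl⟩ := exists_polynomial_of_mem_supported hF
  refine ⟨∑ i ∈ Finset.range (p.natDegree + 1), p.coeff i * σ ^ (p.natDegree - i) * P ^ i,
    sum_mem fun i _ => mul_mem (mul_mem (p.coeff i).2 (pow_mem hσ _)) (pow_mem hP _),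
    p.natDegree, ?_⟩
  suffices h : ∑ i ∈ Finset.range (p.natDegree + 1), p.coeff i * σ ^ (p.natDegree - i) * P ^ i -
      σ ^ p.natDegree * Polynomial.aeval (X N : MvPolynomial ℕ R) p ∈
        Ideal.span {σ * X N - P} by
    obtain ⟨c, hc⟩ := Ideal.mem_span_singleton'.1 h
    exact ⟨c, by rw [hc]; ring⟩
  let g := Ideal.Quotient.mk (Ideal.span {σ * X N - P})
  rw [← Ideal.Quotient.eq_zero_iff_mem]
  change g _ = 0
  have hg : g σ * g (X N) = g P := by
    rw [← sub_eq_zero, ← map_mul, ← map_sub]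
    exact Ideal.Quotient.eq_zero_iff_mem.2 (Ideal.mem_span_singleton_self _)
  rw [map_sub, sub_eq_zero, map_mul, map_aeval_X, map_sum, Finset.mul_sum]
  refine Finset.sum_congr rfl fun i hi => ?_
  rw [map_mul, map_mul, map_pow, map_pow, ← hg, mul_pow, map_pow]
  have : p.natDegree = (p.natDegree - i) + i := by
    have := Finset.mem_range.1 hi
    omega
  conv_rhs => rw [this, pow_add]
  ring

/-- A homomorphism which vanishes on the part of `ker π` involving few variables, and on
equations determining the later algebraic variables, vanishes on `ker π`. -/
lemma eq_zero_of_leaders {R A k : Type*} [CommRing R] [CommRing A] [Field k]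
    (π : MvPolynomial ℕ R →+* A) (φ : MvPolynomial ℕ R →+* k) (M : ℕ)
    (h0 : ∀ F ∈ supported R (Set.Iio M), π F = 0 → φ F = 0)
    (h1 : ∀ N, M ≤ N → IsTransAt π N ∨ ∃ σ ∈ supported R (Set.Iio N),
      ∃ P ∈ supported R (Set.Iio N), φ σ ≠ 0 ∧ π (σ * X N - P) = 0 ∧ φ (σ * X N - P) = 0)
    (F : MvPolynomial ℕ R) (hF : π F = 0) : φ F = 0 := by
  have key : ∀ N, M ≤ N → ∀ F ∈ supported R (Set.Iio N), π F = 0 → φ F = 0 := by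
    intro N hN
    induction N, hN using Nat.le_induction with
    | base => exact h0
    | succ N hN ih =>
      intro F hF hF0
      rcases h1 N hN with h | ⟨σ, hσ, P, hP, hφσ, hπ, hφ⟩
      · obtain ⟨p, rfl⟩ := exists_polynomial_of_mem_supported hF
        rw [map_aeval_X]
        refine Finset.sum_eq_zero fun i _ => ?_
        rw [ih _ (p.coeff i).2 (h p hF0 i), zero_mul]
      · obtain ⟨F', hF', e, c, rfl⟩ := exists_pseudo_remainder hF hσ hP
        have h2 := ih _ hF' (by rw [map_add, map_mul, map_mul, hπ, hF0, mul_zero, mul_zero, add_zero])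
        rw [map_add, map_mul, map_mul, hφ, mul_zero, add_zero, map_pow] at h2
        exact (mul_eq_zero.1 h2).resolve_left (pow_ne_zero _ hφσ)
  obtain ⟨N, hN⟩ : ∃ N, F.vars ⊆ Finset.range N := F.vars.exists_nat_subset_range
  refine key (max M N) (le_max_left _ _) F (mem_supported.2 fun i hi => ?_) hF
  have := Finset.mem_range.1 (hN hi)
  exact lt_of_lt_of_le this (le_max_right _ _)

lemma IsShift.mem_supported {R : Type*} [CommRing R]
    {D : Derivation ℤ (MvPolynomial ℕ R) (MvPolynomial ℕ R)} {m : ℕ} (hD : IsShift D m) {N : ℕ}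
    {F : MvPolynomial ℕ R} (hF : F ∈ supported R (Set.Iio N)) :
    D F ∈ supported R (Set.Iio (N + m)) := by
  have hle : supported R (Set.Iio N) ≤ supported R (Set.Iio (N + m)) :=
    supported_mono (Set.Iio_subset_Iio (Nat.le_add_right N m))
  induction hF using Algebra.adjoin_induction with
  | mem x hx =>
    obtain ⟨i, hi, rfl⟩ := hx
    rw [hD.2]
    exact X_mem_supported_Iio (Nat.add_lt_add_right hi m)
  | algebraMap r =>
    obtain ⟨r', hr'⟩ := hD.1 r
    rw [algebraMap_eq, hr']
    exact Subalgebra.algebraMap_mem _ r'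
  | add x y _ _ hx hy => rw [map_add]; exact add_mem hx hy
  | mul x y hx' hy' hx hy =>
    rw [Derivation.leibniz, smul_eq_mul, smul_eq_mul]
    exact add_mem (mul_mem (hle hx') hy) (mul_mem (hle hy') hx)

lemma IsShift.apply_aeval_X {R : Type*} [CommRing R]
    {D : Derivation ℤ (MvPolynomial ℕ R) (MvPolynomial ℕ R)} {m : ℕ} (hm : 0 < m)
    (hD : IsShift D m) {N : ℕ} (p : Polynomial (supported R (Set.Iio N))) :
    ∃ P ∈ supported R (Set.Iio (N + m)), D (Polynomial.aeval (X N : MvPolynomial ℕ R) p) =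
      Polynomial.aeval (X N : MvPolynomial ℕ R) (Polynomial.derivative p) * X (N + m) - P := by
  induction p using Polynomial.induction_on' with
  | add p q hp hq =>
    obtain ⟨P, hP, hP'⟩ := hp
    obtain ⟨Q, hQ, hQ'⟩ := hq
    refine ⟨P + Q, add_mem hP hQ, ?_⟩
    rw [map_add, map_add, map_add, map_add, hP', hQ']
    ring
  | monomial i a =>
    refine ⟨-(X N ^ i * D (a : MvPolynomial ℕ R)), neg_mem (mul_mem
      (pow_mem (X_mem_supported_Iio (by omega)) i) (hD.mem_supported a.2)), ?_⟩
    rw [Polynomial.derivative_monomial, Polynomial.aeval_monomial, Polynomial.aeval_monomial,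
      Derivation.leibniz, Derivation.leibniz_pow, hD.2]
    simp only [Subalgebra.algebraMap_def, Algebra.algebraMap_self_apply, map_mul, map_natCast, smul_eq_mul,
      nsmul_eq_mul]
    ring

lemma exists_leader {R A : Type*} [CommRing R] [CommRing A] [IsDomain A] [CharZero A]
    {D : Derivation ℤ (MvPolynomial ℕ R) (MvPolynomial ℕ R)} {m : ℕ} (hm : 0 < m)
    (hD : IsShift D m) (π : MvPolynomial ℕ R →+* A) {N : ℕ} (hN : ¬ IsTransAt π N)
    (hπ : ∀ F, π F = 0 → π (D F) = 0) :
    ∃ σ ∈ supported R (Set.Iio (N + 1)), π σ ≠ 0 ∧ ∃ h ∈ supported R (Set.Iio (N + m + 1)), π h = 0 ∧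
      ∀ k, ∃ P ∈ supported R (Set.Iio (N + (k + 1) * m)), D^[k] h = σ * X (N + (k + 1) * m) - P := by
  classical
  let S := MvPolynomial ℕ R
  have hex : ∃ e, ∃ p : Polynomial (supported R (Set.Iio N)), p.natDegree = e ∧
      π (Polynomial.aeval (X N : MvPolynomial ℕ R) p) = 0 ∧
      ∃ i, π (p.coeff i : MvPolynomial ℕ R) ≠ 0 := by
    unfold IsTransAt at hN
    push Not at hN
    obtain ⟨p, hp, hi⟩ := hN
    exact ⟨_, p, rfl, hp, hi⟩
  obtain ⟨p, hpe, hp0, i, hi⟩ := Nat.find_spec hex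
  have hmin := fun e (he : e < Nat.find hex) => Nat.find_min hex he
  have hdeg : p.natDegree ≠ 0 := by
    intro h0
    rw [Polynomial.eq_C_of_natDegree_eq_zero h0, Polynomial.aeval_C] at hp0
    rcases Nat.eq_zero_or_pos i with rfl | hpos
    · exact hi hp0
    · rw [Polynomial.coeff_eq_zero_of_natDegree_lt (by omega)] at hi
      simp at hi
  let σ : S := Polynomial.aeval (X N : S) (Polynomial.derivative p)
  have hσ : π σ ≠ 0 := by
    intro hσ
    have h1 := hmin _ (hpe ▸ Polynomial.natDegree_derivative_lt hdeg)
    push Not at h1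
    have h2 := h1 (Polynomial.derivative p) rfl hσ
    have h3 : ∀ j, π (p.coeff (j + 1) : S) = 0 := by
      intro j
      have := h2 j
      rw [Polynomial.coeff_derivative] at this
      push_cast at this
      rw [map_mul, mul_eq_zero] at this
      refine this.resolve_right ?_
      simp only [map_add, map_natCast, map_one]
      exact Nat.cast_add_one_ne_zero j
    rcases i with _ | i
    · rw [map_aeval_X, Finset.sum_range_succ', Finset.sum_eq_zero fun j _ => by rw [h3, zero_mul],
        zero_add, pow_zero, mul_one] at hp0
      exact hi hp0
    · exact hi (h3 i)
  have hσ' : σ ∈ supported R (Set.Iio (N + 1)) := aeval_X_mem_supported _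
  have hmono : ∀ {a b : ℕ}, a ≤ b → supported R (Set.Iio a) ≤ supported R (Set.Iio b) :=
    fun hab => supported_mono (Set.Iio_subset_Iio hab)
  let h := D (Polynomial.aeval (X N : S) p)
  have hh : ∃ P ∈ supported R (Set.Iio (N + m)), h = σ * X (N + m) - P := IsShift.apply_aeval_X hm hD p
  refine ⟨σ, hσ', hσ, h, ?_, hπ _ hp0, fun k => ?_⟩
  · have := hD.mem_supported (aeval_X_mem_supported p)
    rwa [show N + 1 + m = N + m + 1 by ring] at this
  · induction k with
    | zero => simpa using hh
    | succ k ih =>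
      obtain ⟨P, hP, hP'⟩ := ih
      refine ⟨D P - X (N + (k + 1) * m) * D σ, sub_mem ?_ (mul_mem ?_ ?_), ?_⟩
      · have := hD.mem_supported hP
        rwa [show N + (k + 1) * m + m = N + (k + 1 + 1) * m by ring] at this
      · exact X_mem_supported_Iio (by nlinarith)
      · exact hmono (by nlinarith) (hD.mem_supported hσ')
      · rw [Function.iterate_succ_apply', hP', map_sub, Derivation.leibniz, hD.2, smul_eq_mul,
          smul_eq_mul, show N + (k + 1) * m + m = N + (k + 1 + 1) * m by ring]
        ring

lemma supported_Iio_mono {R : Type*} [CommRing R] {a b : ℕ} (hab : a ≤ b) :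
    supported R (Set.Iio a) ≤ supported R (Set.Iio b) :=
  supported_mono (Set.Iio_subset_Iio hab)

lemma exists_forall_mem_supported_Iio {R : Type*} [CommRing R] (F : MvPolynomial ℕ R) :
    ∃ M, ∀ N, M ≤ N → F ∈ supported R (Set.Iio N) := by
  obtain ⟨M, hM⟩ : ∃ N, F.vars ⊆ Finset.range N := F.vars.exists_nat_subset_range
  refine ⟨M, fun N hN => mem_supported.2 fun i hi => ?_⟩
  exact lt_of_lt_of_le (Finset.mem_range.1 (hM hi)) hN

/-- A differential quotient domain of `MvPolynomial ℕ R` is determined by finitely many leading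
coefficients `σ` (dividing `s`) and equations in the first `M` variables. -/
lemma exists_leaders {R A : Type*} [CommRing R] [CommRing A] [IsDomain A] [CharZero A]
    {D : Derivation ℤ (MvPolynomial ℕ R) (MvPolynomial ℕ R)} {m : ℕ} (hm : 0 < m)
    (hD : IsShift D m) (π : MvPolynomial ℕ R →+* A) (hπ : ∀ F, π F = 0 → π (D F) = 0) :
    ∃ M₀, ∃ s : MvPolynomial ℕ R, π s ≠ 0 ∧ ∀ M, M₀ ≤ M → s ∈ supported R (Set.Iio M) ∧
      ∀ N, M ≤ N → IsTransAt π N ∨ ∃ σ ∈ supported R (Set.Iio M), σ ∣ s ∧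
        ∃ h ∈ supported R (Set.Iio M), π h = 0 ∧
        ∃ P ∈ supported R (Set.Iio N), ∃ k, D^[k] h = σ * X N - P := by
  have hr : ∀ r : Fin m, ∃ M₀, ∃ s ∈ supported R (Set.Iio M₀), π s ≠ 0 ∧
      ∀ N, M₀ ≤ N → N % m = r → IsTransAt π N ∨
        ∃ h ∈ supported R (Set.Iio M₀), π h = 0 ∧
        ∃ P ∈ supported R (Set.Iio N), ∃ k, D^[k] h = s * X N - P := by
    intro r
    by_cases hex : ∃ N, N % m = r ∧ ¬ IsTransAt π N
    · obtain ⟨N, hNr, hN⟩ := hex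
      obtain ⟨σ, hσ, hσ0, h, hh, hh0, hk⟩ := exists_leader hm hD π hN hπ
      refine ⟨N + m + 1, σ, supported_Iio_mono (by omega) hσ, hσ0, fun N' hN' hNr' => Or.inr
        ⟨h, hh, hh0, ?_⟩⟩
      have hmod : N ≡ N' [MOD m] := hNr.trans hNr'.symm
      obtain ⟨j, hj⟩ := (Nat.modEq_iff_dvd' (by omega)).1 hmod
      have hj0 : j ≠ 0 := by rintro rfl; simp at hj; omega
      obtain ⟨k, rfl⟩ := Nat.exists_eq_succ_of_ne_zero hj0
      have hN'' : N' = N + (k + 1) * m := by rw [mul_comm]; simp at hj; omega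
      obtain ⟨P, hP, hP'⟩ := hk k
      exact ⟨P, hN'' ▸ hP, k, hN'' ▸ hP'⟩
    · refine ⟨0, 1, one_mem _, by simp, fun N _ hNr => Or.inl ?_⟩
      by_contra h
      exact hex ⟨N, hNr, h⟩
  choose M₀ s hs hs0 hlead using hr
  refine ⟨Finset.univ.sup M₀, ∏ r, s r, by rw [map_prod]; exact Finset.prod_ne_zero_iff.2 fun r _ => hs0 r,
    fun M hM => ?_⟩
  have hle : ∀ r, M₀ r ≤ M := fun r => (Finset.le_sup (Finset.mem_univ r)).trans hM
  refine ⟨prod_mem fun r _ => supported_Iio_mono (hle r) (hs r), fun N hN => ?_⟩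
  let r : Fin m := ⟨N % m, Nat.mod_lt _ hm⟩
  rcases hlead r N ((hle r).trans hN) rfl with h | ⟨h, hh, hh0, P, hP, k, hk⟩
  · exact Or.inl h
  · exact Or.inr ⟨s r, supported_Iio_mono (hle r) (hs r), Finset.dvd_prod_of_mem s (Finset.mem_univ r),
      h, supported_Iio_mono (hle r) hh, hh0, P, hP, k, hk⟩

lemma iterate_eq_zero {R A : Type*} [CommRing R] [CommRing A] {D : R → R} {π : R →+* A}
    (hπ : ∀ F, π F = 0 → π (D F) = 0) {F : R} (hF : π F = 0) (k : ℕ) : π (D^[k] F) = 0 := by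
  induction k with
  | zero => exact hF
  | succ k ih => rw [Function.iterate_succ_apply']; exact hπ _ ih

/-- Over a field, a prime differential ideal is determined, on an open set, by finitely many of its
elements. -/
lemma exists_finite_determination.{w} {K : Type*} {A : Type*} [Field K] [CommRing A] [IsDomain A] [CharZero A]
    {D : Derivation ℤ (MvPolynomial ℕ K) (MvPolynomial ℕ K)} {m : ℕ} (hm : 0 < m)
    (hD : IsShift D m) (π : MvPolynomial ℕ K →+* A) (hπ : ∀ F, π F = 0 → π (D F) = 0) :
    ∃ (F₀ : Finset (MvPolynomial ℕ K)) (s : MvPolynomial ℕ K), (∀ F ∈ F₀, π F = 0) ∧ π s ≠ 0 ∧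
      ∀ (k : Type w) [Field k] (φ : MvPolynomial ℕ K →+* k), (∀ F, φ F = 0 → φ (D F) = 0) →
        (∀ F ∈ F₀, φ F = 0) → φ s ≠ 0 → ∀ F, π F = 0 → φ F = 0 := by
  classical
  obtain ⟨M, s, hs, hM⟩ := exists_leaders hm hD π hπ
  obtain ⟨-, hlead⟩ := hM M le_rfl
  have hN : IsNoetherianRing (supported K (Set.Iio M)) :=
    isNoetherianRing_of_ringEquiv _ (supportedEquivMvPolynomial (R := K) (Set.Iio M)).symm.toRingEquiv
  let ρ := π.comp (supported K (Set.Iio M)).val.toRingHom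
  obtain ⟨G, hG⟩ := (isNoetherianRing_iff_ideal_fg _).1 hN (RingHom.ker ρ)
  have hker : ∀ (k : Type w) [Field k] (φ : MvPolynomial ℕ K →+* k),
      (∀ F ∈ G.image (Subtype.val : supported K (Set.Iio M) → _), φ F = 0) →
      ∀ F ∈ supported K (Set.Iio M), π F = 0 → φ F = 0 := by
    intro k _ φ h F hF hF0
    have h1 : RingHom.ker ρ ≤ RingHom.ker (φ.comp (supported K (Set.Iio M)).val.toRingHom) := by
      rw [← hG, Ideal.span_le]
      exact fun g hg => h g (Finset.mem_image_of_mem _ hg)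
    exact h1 (show (⟨F, hF⟩ : supported K (Set.Iio M)) ∈ RingHom.ker ρ from hF0)
  refine ⟨G.image Subtype.val, s, fun F hF => ?_, hs, fun k _ φ hφ hφ0 hφs => ?_⟩
  · obtain ⟨g, hg, rfl⟩ := Finset.mem_image.1 hF
    have : g ∈ RingHom.ker ρ := hG ▸ Ideal.subset_span hg
    exact this
  · refine eq_zero_of_leaders π φ M (hker k φ hφ0) fun N hN => ?_
    rcases hlead N hN with h | ⟨σ, hσ, ⟨c, hc⟩, h, hh, hh0, P, hP, j, hj⟩
    · exact Or.inl h
    · refine Or.inr ⟨σ, supported_Iio_mono hN hσ, P, hP, ?_, ?_, ?_⟩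
      · rintro h0
        exact hφs (by rw [hc, map_mul, h0, zero_mul])
      · rw [← hj]
        exact iterate_eq_zero hπ hh0 j
      · rw [← hj]
        exact iterate_eq_zero hφ (hker k φ hφ0 h hh hh0) j

/-- Strong recursion, with the previous values extended by zero. -/
lemma exists_strong_recursion {k : Type*} [Zero k] (G : ℕ → (ℕ → k) → k) :
    ∃ c : ℕ → k, ∀ N, c N = G N fun i => if i < N then c i else 0 := by
  let c : ℕ → k := WellFounded.fix (C := fun _ => k) Nat.lt_wfRel.wf
    fun N f => G N fun i => if h : i < N then f i h else 0
  refine ⟨c, fun N => ?_⟩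
  have := WellFounded.fix_eq (C := fun _ => k) Nat.lt_wfRel.wf
    (fun N f => G N fun i => if h : i < N then f i h else 0) N
  simp only [dite_eq_ite] at this
  exact this

lemma eval₂Hom_eq_of_mem_supported {R k : Type*} [CommRing R] [CommRing k] (g : R →+* k) {N : ℕ}
    {c c' : ℕ → k} (h : ∀ i < N, c i = c' i) {F : MvPolynomial ℕ R}
    (hF : F ∈ supported R (Set.Iio N)) : eval₂Hom g c F = eval₂Hom g c' F :=
  eval₂Hom_congr' rfl (fun i hi _ => h i (mem_supported.1 hF hi)) rfl

/-- Points of a finitely generated subalgebra of a differentially generated domain extend, outside a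
hypersurface, to the whole algebra. -/
lemma exists_ne_zero_forall_extend.{w} {R A T : Type*} [CommRing R] [CommRing A] [IsDomain A] [CharZero A]
    [Algebra R A] {D : Derivation ℤ (MvPolynomial ℕ R) (MvPolynomial ℕ R)} {m : ℕ} (hm : 0 < m)
    (hD : IsShift D m) (π : MvPolynomial ℕ R →ₐ[R] A) (hπs : Function.Surjective π)
    (hπ : ∀ F, π F = 0 → π (D F) = 0)
    [CommRing T] [IsDomain T] [Algebra R T] [Algebra.FiniteType R T] (θ : T →ₐ[R] A)
    (hθ : Function.Injective θ) :
    ∃ t : T, t ≠ 0 ∧ ∀ (k : Type w) [Field k] [IsAlgClosed k] (ψ : T →+* k), ψ t ≠ 0 →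
      ∃ Ψ : A →+* k, ∀ x, Ψ (θ x) = ψ x := by
  classical
  obtain ⟨M₀, s, hs, hlead⟩ := exists_leaders hm hD π.toRingHom hπ
  have hT : ∃ M₁, ∀ M, M₁ ≤ M → θ.range ≤ (supported R (Set.Iio M)).map π := by
    obtain ⟨g, hg⟩ := (inferInstance : Algebra.FiniteType R T).out
    choose f hf using fun x => hπs (θ x)
    choose L hL using fun F : MvPolynomial ℕ R => exists_forall_mem_supported_Iio F
    refine ⟨g.sup fun x => L (f x), fun M hM => ?_⟩
    rw [← Algebra.map_top, ← hg, AlgHom.map_adjoin, Algebra.adjoin_le_iff]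
    rintro _ ⟨x, hx, rfl⟩
    exact ⟨f x, hL _ _ ((Finset.le_sup (f := fun x => L (f x)) hx).trans hM), hf x⟩
  obtain ⟨M₁, hM₁⟩ := hT
  let M := max M₀ M₁
  obtain ⟨hsM, hleadM⟩ := hlead M (le_max_left _ _)
  let C : Subalgebra R A := (supported R (Set.Iio M)).map π
  have hCθ : θ.range ≤ C := hM₁ M (le_max_right _ _)
  have hCfg : Algebra.FiniteType R C := by
    refine (Subalgebra.fg_iff_finiteType C).1 (Subalgebra.FG.map _ ?_)
    exact ⟨((Set.finite_Iio M).image X).toFinset, by simp [supported]⟩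
  let sC : C := ⟨π s, s, hsM, rfl⟩
  have hsC : sC ≠ 0 := fun h => hs (congrArg Subtype.val h)
  let L := Localization.Away sC
  let θC : T →ₐ[R] C := θ.codRestrict C fun x => hCθ ⟨x, rfl⟩
  have hθC : Function.Injective θC := fun x y h => hθ (congrArg Subtype.val h)
  let θL : T →ₐ[R] L := (IsScalarTower.toAlgHom R C L).comp θC
  have hθL : Function.Injective θL := (IsLocalization.injective L
    (powers_le_nonZeroDivisors_of_noZeroDivisors hsC)).comp hθC
  let := θL.toRingHom.toAlgebra
  have : IsScalarTower R T L := IsScalarTower.of_algebraMap_eq fun r => (θL.commutes r).symm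
  have hCL : Algebra.FiniteType C L := IsLocalization.finiteType_of_monoid_fg (Submonoid.powers sC) _
  have hRL : Algebra.FiniteType R L := Algebra.FiniteType.trans hCfg hCL
  have hTL : Algebra.FiniteType T L := Algebra.FiniteType.of_restrictScalars_finiteType R T L
  obtain ⟨t, ht, hlift⟩ := exists_ne_zero_forall_lift.{w} T L hθL
  refine ⟨t, ht, fun k _ _ ψ hψ => ?_⟩
  obtain ⟨ψL, hψL⟩ := hlift k ψ hψ
  let ψC : C →+* k := ψL.comp (algebraMap C L)
  let g : R →+* k := ψC.comp (algebraMap R C)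
  have hψs : ψC sC ≠ 0 := ((IsLocalization.Away.algebraMap_isUnit (S := L) sC).map ψL).ne_zero
  let Lead : ℕ → MvPolynomial ℕ R → MvPolynomial ℕ R → Prop := fun N σ P =>
    σ ∈ supported R (Set.Iio M) ∧ σ ∣ s ∧ P ∈ supported R (Set.Iio N) ∧ π (σ * X N - P) = 0
  let G : ℕ → (ℕ → k) → k := fun N c =>
    if h : N < M then ψC ⟨π (X N), X N, X_mem_supported_Iio h, rfl⟩ else
    if h : ∃ σ P, Lead N σ P then
      eval₂Hom g c h.choose_spec.choose / eval₂Hom g c h.choose else 0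
  obtain ⟨c, hc⟩ := exists_strong_recursion G
  let φ : MvPolynomial ℕ R →+* k := eval₂Hom g c
  have hφM : ∀ F (hF : F ∈ supported R (Set.Iio M)), φ F = ψC ⟨π F, F, hF, rfl⟩ := by
    intro F hF
    induction hF using Algebra.adjoin_induction with
    | mem x hx =>
      obtain ⟨i, hi, rfl⟩ := hx
      simp only [φ, coe_eval₂Hom, eval₂_X, hc i, G]
      rw [dif_pos (show i < M from hi)]
    | algebraMap r =>
      simp only [φ, coe_eval₂Hom, algebraMap_eq, eval₂_C, g, RingHom.comp_apply ψC]
      congr 1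
      exact Subtype.ext (π.commutes r).symm
    | add x y hx' hy' hx hy =>
      rw [map_add, hx, hy, ← map_add]
      congr 1
      exact Subtype.ext (map_add π x y).symm
    | mul x y hx' hy' hx hy =>
      rw [map_mul, hx, hy, ← map_mul]
      congr 1
      exact Subtype.ext (map_mul π x y).symm
  have hφs : φ s ≠ 0 := by rw [hφM s hsM]; exact hψs
  have hφσ : ∀ σ, σ ∣ s → φ σ ≠ 0 := by
    rintro σ ⟨a, ha⟩ h0
    exact hφs (by rw [ha, map_mul, h0, zero_mul])
  have hkill : ∀ F, π F = 0 → φ F = 0 := by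
    refine eq_zero_of_leaders π.toRingHom φ M (fun F hF hF0 => ?_) fun N hN => ?_
    · rw [hφM F hF, ← map_zero ψC]
      exact congrArg ψC (Subtype.ext hF0)
    · rcases hleadM N hN with h | ⟨σ, hσ, hσs, h, hh, hh0, P, hP, j, hj⟩
      · exact Or.inl h
      · have hex : ∃ σ P, Lead N σ P :=
          ⟨σ, P, hσ, hσs, hP, by rw [← hj]; exact iterate_eq_zero (π := π.toRingHom) hπ hh0 j⟩
        obtain ⟨h1, h2, h3, h4⟩ := hex.choose_spec.choose_spec
        refine Or.inr ⟨hex.choose, supported_Iio_mono hN h1, hex.choose_spec.choose, h3, hφσ _ h2, h4, ?_⟩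
        have hcN : c N = φ hex.choose_spec.choose / φ hex.choose := by
          rw [hc N]
          simp only [G]
          rw [dif_neg (not_lt.2 hN), dif_pos hex]
          rw [eval₂Hom_eq_of_mem_supported g (c' := c) (fun i hi => if_pos hi) h3,
            eval₂Hom_eq_of_mem_supported g (c' := c) (fun i hi => if_pos hi)
              (supported_Iio_mono hN h1)]
        have hX : φ (X N) = c N := by simp [φ]
        rw [map_sub, map_mul, hX, hcN, mul_div_cancel₀ _ (hφσ _ h2), sub_self]
  let Ψ : A →+* k := RingHom.liftOfSurjective π.toRingHom hπs ⟨φ, fun F hF => hkill F hF⟩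
  have hΨ : ∀ F, Ψ (π F) = φ F := fun F => RingHom.liftOfRightInverse_comp_apply _ _ _ _ F
  refine ⟨Ψ, fun x => ?_⟩
  obtain ⟨F, hF, hFx⟩ := hCθ ⟨x, rfl⟩
  have hFx' : π F = θ x := hFx
  rw [← hFx', hΨ, hφM F hF, ← hψL x]
  refine congrArg (fun y => ψL (algebraMap C L y)) ?_
  exact Subtype.ext hFx'

section Taylor

variable {A k : Type*} [CommRing A] [Field k]

/-- The Taylor series of an element of a differential ring at a point. -/
noncomputable def taylorSeries (δ : Derivation ℤ A A) (ψ : A →+* k) (a : A) : PowerSeries k :=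
  PowerSeries.mk fun n => ψ (δ^[n] a) / (n.factorial : k)

lemma taylorSeries_add (δ : Derivation ℤ A A) (ψ : A →+* k) (a b : A) :
    taylorSeries δ ψ (a + b) = taylorSeries δ ψ a + taylorSeries δ ψ b := by
  ext n
  simp only [taylorSeries, PowerSeries.coeff_mk, map_add, iterate_map_add, add_div]

lemma constantCoeff_taylorSeries (δ : Derivation ℤ A A) (ψ : A →+* k) (a : A) :
    PowerSeries.constantCoeff (taylorSeries δ ψ a) = ψ a := by
  simp [taylorSeries]

variable [CharZero k]

lemma derivative_taylorSeries (δ : Derivation ℤ A A) (ψ : A →+* k) (a : A) :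
    PowerSeries.derivative k (taylorSeries δ ψ a) = taylorSeries δ ψ (δ a) := by
  ext n
  rw [PowerSeries.coeff_derivative, taylorSeries, taylorSeries, PowerSeries.coeff_mk,
    PowerSeries.coeff_mk, Nat.factorial_succ, Function.iterate_succ_apply]
  have : (n.factorial : k) ≠ 0 := Nat.cast_ne_zero.2 n.factorial_ne_zero
  have : (n + 1 : k) ≠ 0 := Nat.cast_add_one_ne_zero n
  push_cast
  field_simp

lemma taylorSeries_mul (δ : Derivation ℤ A A) (ψ : A →+* k) (a b : A) :
    taylorSeries δ ψ (a * b) = taylorSeries δ ψ a * taylorSeries δ ψ b := by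
  ext n
  induction n generalizing a b with
  | zero =>
    simp only [PowerSeries.coeff_zero_eq_constantCoeff_apply, map_mul, constantCoeff_taylorSeries]
  | succ n ih =>
    have h0 : (n + 1 : k) ≠ 0 := Nat.cast_add_one_ne_zero n
    refine mul_right_cancel₀ h0 ?_
    rw [← PowerSeries.coeff_derivative, ← PowerSeries.coeff_derivative, derivative_taylorSeries,
      Derivation.leibniz, Derivation.leibniz, derivative_taylorSeries, derivative_taylorSeries,
      taylorSeries_add, map_add, map_add, smul_eq_mul, smul_eq_mul, smul_eq_mul, smul_eq_mul, ih, ih]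

/-- The Taylor map as a ring homomorphism. -/
noncomputable def taylorHom (δ : Derivation ℤ A A) (ψ : A →+* k) : A →+* PowerSeries k :=
  RingHom.mk' ⟨⟨taylorSeries δ ψ, by
    ext n
    simp only [taylorSeries, PowerSeries.coeff_mk]
    rcases n with _ | n
    · simp
    · rw [Function.iterate_succ_apply, Derivation.map_one_eq_zero, iterate_map_zero, map_zero,
        zero_div, PowerSeries.coeff_one, if_neg (Nat.succ_ne_zero n)]⟩, taylorSeries_mul δ ψ⟩
    (taylorSeries_add δ ψ)

lemma constantCoeff_taylorHom (δ : Derivation ℤ A A) (ψ : A →+* k) (a : A) :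
    PowerSeries.constantCoeff (taylorHom δ ψ a) = ψ a := constantCoeff_taylorSeries δ ψ a

lemma derivative_taylorHom (δ : Derivation ℤ A A) (ψ : A →+* k) (a : A) :
    PowerSeries.derivative k (taylorHom δ ψ a) = taylorHom δ ψ (δ a) :=
  derivative_taylorSeries δ ψ a

lemma taylorHom_congr {B : Type*} [CommRing B] (δA : Derivation ℤ A A) (δB : Derivation ℤ B B)
    (ψ : A →+* k) (ψ' : B →+* k) {a : A} {b : B} (h : ∀ n, ψ (δA^[n] a) = ψ' (δB^[n] b)) :
    taylorHom δA ψ a = taylorHom δB ψ' b := by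
  change taylorSeries δA ψ a = taylorSeries δB ψ' b
  ext n
  simp only [taylorSeries, PowerSeries.coeff_mk, h]

end Taylor

section Fibres

variable {R T U : Type u} [CommRing R] [IsDomain R] [CommRing T] [Algebra R T]
  [Algebra.FiniteType R T] [CommRing U] [Algebra R U]

lemma exists_ne_zero_forall_of_prime [CharZero R] {D : Derivation ℤ (MvPolynomial ℕ R) (MvPolynomial ℕ R)}
    {m : ℕ} (hm : 0 < m) (hD : IsShift D m) (δ : Derivation ℤ U U) (π : MvPolynomial ℕ R →ₐ[R] U)
    (hπs : Function.Surjective π) (hπ : ∀ F, π (D F) = δ (π F)) (θ : T →ₐ[R] U)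
    (p : Ideal T) [p.IsPrime] (Q : Ideal U) [Q.IsPrime] (hQ : ∀ x ∈ Q, δ x ∈ Q)
    (hpQ : ∀ x, θ x ∈ Q ↔ x ∈ p) (hpR : ∀ r, algebraMap R T r ∈ p → r = 0) :
    ∃ d : R, d ≠ 0 ∧ ∀ (k₀ : Type u) [Field k₀] [Algebra R k₀], algebraMap R k₀ d ≠ 0 →
      ∀ z : k₀ ⊗[R] T, Algebra.TensorProduct.map (AlgHom.id k₀ k₀) θ z = 0 →
      ∀ (k : Type u) [Field k] (χ : k₀ ⊗[R] T →+* k), (∀ x ∈ p, χ (1 ⊗ₜ x) = 0) → χ z = 0 := by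
  let A := U ⧸ Q
  let B := T ⧸ p
  have hA : CharZero A := by
    refine charZero_of_injective_algebraMap (R := R) ((injective_iff_map_eq_zero _).2 fun r hr => ?_)
    refine hpR r ((hpQ _).1 ?_)
    rw [AlgHom.commutes]
    exact Ideal.Quotient.eq_zero_iff_mem.1 hr
  let θ' : B →ₐ[R] A := Ideal.Quotient.liftₐ p ((Ideal.Quotient.mkₐ R Q).comp θ)
    fun x hx => Ideal.Quotient.eq_zero_iff_mem.2 ((hpQ x).2 hx)
  have hθ'mk : ∀ x, θ' (Ideal.Quotient.mkₐ R p x) = Ideal.Quotient.mkₐ R Q (θ x) := fun x => rfl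
  have hθ' : Function.Injective θ' := by
    refine (injective_iff_map_eq_zero _).2 fun x hx => ?_
    obtain ⟨x, rfl⟩ := Ideal.Quotient.mkₐ_surjective R p x
    rw [hθ'mk] at hx
    exact Ideal.Quotient.eq_zero_iff_mem.2 ((hpQ x).1 (Ideal.Quotient.eq_zero_iff_mem.1 hx))
  have hBft : Algebra.FiniteType R B :=
    Algebra.FiniteType.of_surjective (Ideal.Quotient.mkₐ R p) (Ideal.Quotient.mkₐ_surjective R p)
  obtain ⟨t, ht, hE⟩ := exists_ne_zero_forall_extend.{u} hm hD ((Ideal.Quotient.mkₐ R Q).comp π)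
    ((Ideal.Quotient.mkₐ_surjective R Q).comp hπs) (fun F hF => by
      change Ideal.Quotient.mk Q (π (D F)) = 0
      rw [hπ, Ideal.Quotient.eq_zero_iff_mem]
      exact hQ _ (Ideal.Quotient.eq_zero_iff_mem.1 hF)) θ' hθ'
  obtain ⟨d, hd, hb⟩ := exists_ne_zero_forall_nonZeroDivisor.{u} R B t
    fun x hx => (mul_eq_zero.1 hx).resolve_left ht
  refine ⟨d, hd, fun k₀ _ _ hk z hz k _ χ hχ => ?_⟩
  by_contra hχz
  let zi : k₀ ⊗[R] B := Algebra.TensorProduct.map (AlgHom.id k₀ k₀) (Ideal.Quotient.mkₐ R p) z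
  have hzi : ¬ IsNilpotent zi := by
    let := (χ.comp (algebraMap R (k₀ ⊗[R] T))).toAlgebra
    let χ' : k₀ ⊗[R] T →ₐ[R] k := { χ with commutes' := fun r => rfl }
    let χB : B →ₐ[R] k := Ideal.Quotient.liftₐ p (χ'.comp Algebra.TensorProduct.includeRight) hχ
    let χ₂ : k₀ ⊗[R] B →ₐ[R] k := Algebra.TensorProduct.lift
      (χ'.comp Algebra.TensorProduct.includeLeft) χB fun _ _ => Commute.all _ _
    have h : χ₂.comp (Algebra.TensorProduct.map (AlgHom.id R k₀) (Ideal.Quotient.mkₐ R p)) = χ' := by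
      refine Algebra.TensorProduct.ext ?_ ?_
      · ext x
        simp [χ₂]
      · ext x
        simp only [AlgHom.comp_apply, AlgHom.restrictScalars_apply,
          Algebra.TensorProduct.includeRight_apply, Algebra.TensorProduct.map_tmul, map_one, χ₂,
          Algebra.TensorProduct.lift_tmul, one_mul]
        rfl
    intro hn
    have h2 := hn.map χ₂
    have h3 : χ₂ zi = χ z := DFunLike.congr_fun h z
    rw [h3] at h2
    exact hχz h2.eq_zero
  have hzt : ¬ IsNilpotent ((1 ⊗ₜ t) * zi) := by
    rintro ⟨N, hN⟩
    rw [mul_pow] at hN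
    have key : ∀ N, ∀ y : k₀ ⊗[R] B, (1 ⊗ₜ t) ^ N * y = 0 → y = 0 := by
      intro N
      induction N with
      | zero => intro y hy; simpa using hy
      | succ N ih =>
        intro y hy
        rw [pow_succ, mul_assoc] at hy
        exact hb k₀ hk _ (ih _ hy)
    exact hzi ⟨N, key N _ hN⟩
  obtain ⟨k', _, _, χ', hχ'⟩ := exists_ringHom_algClosed_ne_zero hzt
  rw [map_mul] at hχ'
  let := (χ'.comp (algebraMap R (k₀ ⊗[R] B))).toAlgebra
  let χ'' : k₀ ⊗[R] B →ₐ[R] k' := { χ' with commutes' := fun r => rfl }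
  obtain ⟨Ψ, hΨ⟩ := hE k' (χ''.comp Algebra.TensorProduct.includeRight).toRingHom
    (left_ne_zero_of_mul hχ')
  let ΨU : U →ₐ[R] k' := { Ψ.comp (Ideal.Quotient.mk Q) with
    commutes' := fun r => by
      have h1 := hΨ (algebraMap R B r)
      rw [AlgHom.commutes] at h1
      have h2 : Ideal.Quotient.mk Q (algebraMap R U r) = algebraMap R A r := rfl
      change Ψ (Ideal.Quotient.mk Q (algebraMap R U r)) = _
      rw [h2, h1]
      exact (χ''.comp Algebra.TensorProduct.includeRight).commutes r }
  let χU : k₀ ⊗[R] U →ₐ[R] k' := Algebra.TensorProduct.lift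
      (χ''.comp Algebra.TensorProduct.includeLeft) ΨU fun _ _ => Commute.all _ _
  have h : χU.comp (Algebra.TensorProduct.map (AlgHom.id R k₀) θ) =
      χ''.comp (Algebra.TensorProduct.map (AlgHom.id R k₀) (Ideal.Quotient.mkₐ R p)) := by
    refine Algebra.TensorProduct.ext ?_ ?_
    · ext x
      simp [χU]
    · ext x
      simp only [AlgHom.comp_apply, AlgHom.restrictScalars_apply,
        Algebra.TensorProduct.includeRight_apply, Algebra.TensorProduct.map_tmul, map_one, χU,
        Algebra.TensorProduct.lift_tmul, one_mul]
      exact hΨ (Ideal.Quotient.mkₐ R p x)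
  have h1 : χU (Algebra.TensorProduct.map (AlgHom.id k₀ k₀) θ z) = χ' zi := DFunLike.congr_fun h z
  rw [hz, map_zero] at h1
  exact right_ne_zero_of_mul hχ' h1.symm

end Fibres

lemma exists_mul_pow_eq_zero_of_mem_minimalPrimes {T : Type*} [CommRing T] {p : Ideal T}
    (hp : p ∈ minimalPrimes T) {x : T} (hx : x ∈ p) : ∃ y ∉ p, ∃ N : ℕ, y * x ^ N = 0 := by
  have hpp : p.IsPrime := hp.1.1
  by_contra! h
  obtain ⟨q, hq, -, hdis⟩ := Ideal.exists_le_prime_disjoint ⊥ (p.primeCompl ⊔ Submonoid.powers x) (by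
    rw [Set.disjoint_left]
    rintro a (rfl : a = 0) ha
    obtain ⟨y, hy, _, ⟨N, rfl⟩, hyz⟩ := Submonoid.mem_sup.1 ha
    exact h y hy N hyz)
  have hqp : q ≤ p := by
    intro a ha
    by_contra hap
    exact Set.disjoint_left.1 hdis ha (Submonoid.mem_sup_left (S := p.primeCompl) hap)
  exact Set.disjoint_left.1 hdis (hp.2 ⟨hq, bot_le⟩ hqp hx)
    (Submonoid.mem_sup_right (Submonoid.mem_powers x))

/-- The minimal primes of the generic fibre of a finite type algebra over a domain. -/
lemma exists_generic_minimalPrimes (R T : Type*) [CommRing R] [IsDomain R] [CommRing T] [Algebra R T]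
    [Algebra.FiniteType R T] :
    ∃ P : Set (Ideal T), P.Finite ∧ (∀ p ∈ P, p.IsPrime) ∧
      (∀ p ∈ P, ∀ r, algebraMap R T r ∈ p → r = 0) ∧
      (∀ p ∈ P, ∀ x ∈ p, ∃ y ∉ p, ∃ N : ℕ, ∃ r : R, r ≠ 0 ∧ algebraMap R T r * (y * x ^ N) = 0) ∧
      (∀ a : T, (∀ p ∈ P, a ∈ p) → ∃ N : ℕ, ∃ r : R, r ≠ 0 ∧ algebraMap R T r * a ^ N = 0) := by
  let L := FractionRing R
  let TL := L ⊗[R] T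
  let ι : T →ₐ[R] TL := Algebra.TensorProduct.includeRight
  have hTL : IsNoetherianRing TL := Algebra.FiniteType.isNoetherianRing L TL
  have hzero : ∀ x, ι x = 0 → ∃ r : R, r ≠ 0 ∧ algebraMap R T r * x = 0 := by
    intro x hx
    obtain ⟨r, hr⟩ := (IsLocalizedModule.eq_zero_iff (nonZeroDivisors R)
      (TensorProduct.mk R L T 1)).1 hx
    refine ⟨r, nonZeroDivisors.coe_ne_zero r, ?_⟩
    rw [← Algebra.smul_def]
    exact hr
  have hsurj : ∀ y : TL, ∃ (r : R) (x : T), r ≠ 0 ∧ algebraMap R TL r * y = ι x := by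
    intro y
    obtain ⟨⟨x, r⟩, hr⟩ := IsLocalizedModule.surj (nonZeroDivisors R) (TensorProduct.mk R L T 1) y
    refine ⟨r, x, nonZeroDivisors.coe_ne_zero r, ?_⟩
    rw [← Algebra.smul_def]
    exact hr
  have hunit : ∀ r : R, r ≠ 0 → IsUnit (algebraMap R TL r) := by
    intro r hr
    rw [IsScalarTower.algebraMap_apply R L TL]
    refine (IsUnit.mk0 _ ?_).map _
    simpa using hr
  refine ⟨Ideal.comap ι.toRingHom '' minimalPrimes TL,
    (minimalPrimes.finite_of_isNoetherianRing TL).image _, ?_, ?_, ?_, ?_⟩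
  · rintro _ ⟨p, hp, rfl⟩
    have := hp.1.1
    exact Ideal.comap_isPrime _ p
  · rintro _ ⟨p, hp, rfl⟩ r hr
    by_contra h0
    refine hp.1.1.ne_top (Ideal.eq_top_of_isUnit_mem p ?_ (hunit r h0))
    rw [← ι.commutes]
    exact hr
  · rintro _ ⟨p, hp, rfl⟩ x hx
    obtain ⟨y, hy, N, hN⟩ := exists_mul_pow_eq_zero_of_mem_minimalPrimes hp hx
    obtain ⟨r, y', hr, hy'⟩ := hsurj y
    refine ⟨y', fun h => hy ?_, N, hzero _ ?_⟩
    · have h1 : ι y' ∈ p := h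
      rw [← hy'] at h1
      exact ((hp.1.1).mem_or_mem h1).resolve_left fun h2 =>
        hp.1.1.ne_top (Ideal.eq_top_of_isUnit_mem p h2 (hunit r hr))
    · rw [map_mul, map_pow, ← hy', mul_assoc]
      exact mul_eq_zero_of_right _ hN
  · intro a ha
    have h1 : ι a ∈ nilradical TL := by
      rw [nilradical, ← Ideal.sInf_minimalPrimes, Ideal.mem_sInf]
      exact fun p hp => ha _ ⟨p, hp, rfl⟩
    obtain ⟨N, hN⟩ := mem_nilradical.1 h1
    exact ⟨N, hzero _ (by rw [map_pow, hN])⟩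

/-- Every prime of `T` dominated by a generic minimal prime lifts to a differential prime. -/
lemma exists_differential_prime {R T U : Type*} [CommRing R] [CharZero R] [CommRing T] [Algebra R T]
    [CommRing U] [Algebra R U] (δ : Derivation ℤ U U) (θ : T →ₐ[R] U)
    (hker : ∀ z, θ z = 0 → ∃ r : R, r ≠ 0 ∧ ∃ N : ℕ, algebraMap R T r * z ^ N = 0)
    (p : Ideal T) [hp : p.IsPrime] (hpR : ∀ r, algebraMap R T r ∈ p → r = 0)
    (hpmin : ∀ x ∈ p, ∃ y ∉ p, ∃ N : ℕ, ∃ r : R, r ≠ 0 ∧ algebraMap R T r * (y * x ^ N) = 0) :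
    ∃ Q : Ideal U, Q.IsPrime ∧ (∀ x ∈ Q, δ x ∈ Q) ∧ ∀ x, θ x ∈ Q ↔ x ∈ p := by
  obtain ⟨q, hq, -, hdis⟩ := Ideal.exists_le_prime_disjoint ⊥ (p.primeCompl.map θ) (by
    rw [Set.disjoint_left]
    rintro a (rfl : a = 0) ⟨z, hz, hz0⟩
    obtain ⟨r, hr, N, hN⟩ := hker z hz0
    rcases hp.mem_or_mem (show algebraMap R T r * z ^ N ∈ p by rw [hN]; exact p.zero_mem) with h | h
    · exact hr (hpR r h)
    · exact hz (hp.mem_of_pow_mem N h))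
  have hqp : ∀ x, θ x ∈ q → x ∈ p := by
    intro x hx
    by_contra hxp
    exact Set.disjoint_left.1 hdis hx ⟨x, hxp, rfl⟩
  let ψ : U →+* q.ResidueField := algebraMap U q.ResidueField
  have hψ : ∀ x, ψ x = 0 ↔ x ∈ q := fun x => by simp [ψ]
  have hchar : CharZero q.ResidueField := by
    refine charZero_of_injective_algebraMap (R := R) ((injective_iff_map_eq_zero _).2 fun r hr => ?_)
    rw [IsScalarTower.algebraMap_apply R U q.ResidueField] at hr
    refine hpR r (hqp _ ?_)
    rw [AlgHom.commutes]
    exact (hψ _).1 hr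
  let Q := RingHom.ker (taylorHom δ ψ)
  have hQ : Q.IsPrime := RingHom.ker_isPrime _
  have hQq : ∀ x ∈ Q, x ∈ q := by
    intro x hx
    rw [← hψ, ← constantCoeff_taylorHom δ ψ, (RingHom.mem_ker).1 hx, map_zero]
  refine ⟨Q, hQ, fun x hx => ?_, fun x => ⟨fun hx => hqp x (hQq _ hx), fun hx => ?_⟩⟩
  · rw [RingHom.mem_ker, ← derivative_taylorHom, (RingHom.mem_ker).1 hx, map_zero]
  · obtain ⟨y, hy, N, r, hr, hry⟩ := hpmin x hx
    have h0 : algebraMap R U r * (θ y * θ x ^ N) ∈ Q := by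
      rw [← θ.commutes, ← map_pow, ← map_mul, ← map_mul, hry, map_zero]
      exact Q.zero_mem
    rcases hQ.mem_or_mem h0 with h | h
    · refine absurd (hpR r (hqp _ ?_)) hr
      rw [AlgHom.commutes]
      exact hQq _ h
    · rcases hQ.mem_or_mem h with h | h
      · exact absurd (hqp y (hQq _ h)) hy
      · exact hQ.mem_of_pow_mem N h

section Fibres

variable {R T U : Type u} [CommRing R] [IsDomain R] [CommRing T] [Algebra R T]
  [Algebra.FiniteType R T] [CommRing U] [Algebra R U]

/-- The kernel of `T → U` on the fibre at `k₀` is nil. -/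
def HasNilKernelAt (θ : T →ₐ[R] U) (k₀ : Type u) [Field k₀] [Algebra R k₀] : Prop :=
  ∀ z : k₀ ⊗[R] T, Algebra.TensorProduct.map (AlgHom.id k₀ k₀) θ z = 0 → IsNilpotent z

lemma exists_ne_zero_forall_not_hasNilKernelAt (θ : T →ₐ[R] U) (z : T) (hz : θ z = 0)
    (hz' : ∀ r : R, r ≠ 0 → ∀ N : ℕ, algebraMap R T r * z ^ N ≠ 0) :
    ∃ d : R, d ≠ 0 ∧ ∀ (k₀ : Type u) [Field k₀] [Algebra R k₀], algebraMap R k₀ d ≠ 0 →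
      ¬ HasNilKernelAt θ k₀ := by
  let Tz := Localization.Away z
  have hft : Algebra.FiniteType T Tz := IsLocalization.finiteType_of_monoid_fg (Submonoid.powers z) _
  have hft' : Algebra.FiniteType R Tz := Algebra.FiniteType.trans (S := T) ‹_› hft
  obtain ⟨d, hd, hlift⟩ := exists_ne_zero_forall_lift.{u} R Tz (by
    refine (injective_iff_map_eq_zero _).2 fun r hr => ?_
    rw [IsScalarTower.algebraMap_apply R T Tz, IsLocalization.map_eq_zero_iff (Submonoid.powers z)] at hr
    obtain ⟨⟨_, N, rfl⟩, hN⟩ := hr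
    by_contra h0
    exact hz' r h0 N (by rw [mul_comm]; exact hN))
  refine ⟨d, hd, fun k₀ _ _ hk h => ?_⟩
  let kb := AlgebraicClosure k₀
  obtain ⟨ψ, hψ⟩ := hlift kb (algebraMap R kb) (by
    rw [IsScalarTower.algebraMap_apply R k₀ kb]
    simpa using hk)
  let ψT : T →ₐ[R] kb := { ψ.comp (algebraMap T Tz) with
    commutes' := fun r => by rw [← hψ r, IsScalarTower.algebraMap_apply R T Tz]; rfl }
  let χ : k₀ ⊗[R] T →ₐ[R] kb := Algebra.TensorProduct.lift (IsScalarTower.toAlgHom R k₀ kb) ψT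
    fun _ _ => Commute.all _ _
  have hn : IsNilpotent ((1 : k₀) ⊗ₜ[R] z) := h _ (by simp [hz])
  have hχ : χ (1 ⊗ₜ z) = ψ (algebraMap T Tz z) := by
    simp only [χ, Algebra.TensorProduct.lift_tmul, map_one, one_mul]
    rfl
  have h1 := (hn.map χ).eq_zero
  rw [hχ] at h1
  exact ((IsLocalization.Away.algebraMap_isUnit (S := Tz) z).map ψ).ne_zero h1

/-- Nilness of the kernel of `T → U` is generically constant along the base. -/
lemma exists_ne_zero_hasNilKernelAt_or [CharZero R]
    {D : Derivation ℤ (MvPolynomial ℕ R) (MvPolynomial ℕ R)}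
    {m : ℕ} (hm : 0 < m) (hD : IsShift D m) (δ : Derivation ℤ U U) (π : MvPolynomial ℕ R →ₐ[R] U)
    (hπs : Function.Surjective π) (hπ : ∀ F, π (D F) = δ (π F)) (θ : T →ₐ[R] U) :
    ∃ d : R, d ≠ 0 ∧
      ((∀ (k₀ : Type u) [Field k₀] [Algebra R k₀], algebraMap R k₀ d ≠ 0 → HasNilKernelAt θ k₀) ∨
      ∀ (k₀ : Type u) [Field k₀] [Algebra R k₀], algebraMap R k₀ d ≠ 0 → ¬ HasNilKernelAt θ k₀) := by
  classical
  by_cases hker : ∀ z, θ z = 0 → ∃ r : R, r ≠ 0 ∧ ∃ N : ℕ, algebraMap R T r * z ^ N = 0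
  swap
  · push Not at hker
    obtain ⟨z, hz, hz'⟩ := hker
    obtain ⟨d, hd, h⟩ := exists_ne_zero_forall_not_hasNilKernelAt θ z hz hz'
    exact ⟨d, hd, Or.inr h⟩
  obtain ⟨P, hPfin, hPprime, hPR, hPmin, hPnil⟩ := exists_generic_minimalPrimes R T
  have hex : ∀ p : P, ∃ d : R, d ≠ 0 ∧ ∀ (k₀ : Type u) [Field k₀] [Algebra R k₀],
      algebraMap R k₀ d ≠ 0 →
      ∀ z : k₀ ⊗[R] T, Algebra.TensorProduct.map (AlgHom.id k₀ k₀) θ z = 0 →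
      ∀ (k : Type u) [Field k] (χ : k₀ ⊗[R] T →+* k), (∀ x ∈ p.1, χ (1 ⊗ₜ x) = 0) → χ z = 0 := by
    intro p
    have := hPprime p p.2
    obtain ⟨Q, hQ, hQδ, hQp⟩ := exists_differential_prime δ θ hker p.1 (hPR p p.2) (hPmin p p.2)
    exact exists_ne_zero_forall_of_prime hm hD δ π hπs hπ θ p.1 Q hQδ hQp (hPR p p.2)
  choose d hd hdp using hex
  obtain ⟨d₀, hd₀, htors⟩ := exists_ne_zero_forall_torsion.{u} R T
  have := hPfin.fintype
  refine ⟨d₀ * ∏ p, d p, mul_ne_zero hd₀ (Finset.prod_ne_zero_iff.2 fun p _ => hd p),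
    Or.inl fun k₀ _ _ hk z hz => ?_⟩
  rw [map_mul, map_prod] at hk
  by_contra hzn
  obtain ⟨k, _, _, χ, hχ⟩ := exists_ringHom_algClosed_ne_zero hzn
  let χT : T →+* k := χ.comp (Algebra.TensorProduct.includeRight (R := R) (A := k₀)).toRingHom
  have hχT : ∀ x, χT x = χ (1 ⊗ₜ x) := fun x => rfl
  have hχd : χT (algebraMap R T d₀) ≠ 0 := by
    have h1 : χT (algebraMap R T d₀) =
        (χ.comp (algebraMap k₀ (k₀ ⊗[R] T))) (algebraMap R k₀ d₀) := by
      exact congrArg χ ((Algebra.TensorProduct.includeRight (R := R) (A := k₀) (B := T)).commutes d₀)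
    rw [h1]
    exact (map_ne_zero _).2 (left_ne_zero_of_mul hk)
  have hT := htors k χT hχd
  refine hχ ?_
  obtain ⟨p, hp⟩ : ∃ p : P, ∀ x ∈ p.1, χT x = 0 := by
    by_contra! h
    choose a ha ha' using h
    obtain ⟨N, r, hr, hN⟩ := hPnil (∏ p, a p) fun p hp =>
      Ideal.mem_of_dvd p (Finset.dvd_prod_of_mem a (Finset.mem_univ ⟨p, hp⟩)) (ha ⟨p, hp⟩)
    have h2 := hT r _ hr hN
    rw [map_pow, map_prod] at h2
    exact Finset.prod_ne_zero_iff.2 (fun p _ => ha' p) ((IsNilpotent.eq_zero ⟨N, h2⟩))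
  exact hdp p k₀ (Finset.prod_ne_zero_iff.1 (right_ne_zero_of_mul hk) p (Finset.mem_univ p)) z hz k χ hp

end Fibres

section Derivations

lemma exists_derivation_of_section {A : Type*} [CommRing A] [Algebra ℤ A] (E : A →+* TrivSqZeroExt A A)
    (hE : ∀ a, (E a).fst = a) : ∃ D : Derivation ℤ A A, ∀ a, D a = (E a).snd := by
  obtain rfl := Subsingleton.elim (Ring.toIntAlgebra A) ‹Algebra ℤ A›
  refine ⟨Derivation.mk' (AddMonoidHom.toIntLinearMap
    { toFun := fun a => (E a).snd
      map_zero' := by simp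
      map_add' := fun a b => by simp }) fun a b => ?_, fun a => rfl⟩
  simp [hE, mul_comm]

/-- Ring homomorphisms to the dual numbers given by a ring homomorphism and a derivation along
it. -/
noncomputable def dualHom {A B : Type*} [CommRing A] [CommRing B] (φ : A →+* B) (d : A → B)
    (h₁ : ∀ a b, d (a + b) = d a + d b) (h₂ : ∀ a b, d (a * b) = φ a * d b + φ b * d a) :
    A →+* TrivSqZeroExt B B :=
  RingHom.mk' ⟨⟨fun a => TrivSqZeroExt.inl (φ a) + TrivSqZeroExt.inr (d a), by
      have : d 1 = 0 := by simpa using h₂ 1 1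
      simp [this]⟩, fun a b => by
      ext <;> simp [h₂, mul_comm]⟩ fun a b => by ext <;> simp [h₁]

lemma fst_dualHom {A B : Type*} [CommRing A] [CommRing B] (φ : A →+* B) (d : A → B)
    (h₁ : ∀ a b, d (a + b) = d a + d b) (h₂ : ∀ a b, d (a * b) = φ a * d b + φ b * d a) (a : A) :
    (dualHom φ d h₁ h₂ a).fst = φ a := by
  change (TrivSqZeroExt.inl (φ a) + TrivSqZeroExt.inr (d a) : TrivSqZeroExt B B).fst = _
  simp

lemma snd_dualHom {A B : Type*} [CommRing A] [CommRing B] (φ : A →+* B) (d : A → B)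
    (h₁ : ∀ a b, d (a + b) = d a + d b) (h₂ : ∀ a b, d (a * b) = φ a * d b + φ b * d a) (a : A) :
    (dualHom φ d h₁ h₂ a).snd = d a := by
  change (TrivSqZeroExt.inl (φ a) + TrivSqZeroExt.inr (d a) : TrivSqZeroExt B B).snd = _
  simp

lemma exists_derivation_of_isDerivationFn {A : Type*} [CommRing A] {δ : A → A}
    (h : IsDerivationFn δ) : ∃ D : Derivation ℤ A A, ⇑D = δ := by
  obtain ⟨D, hD⟩ := exists_derivation_of_section (dualHom (RingHom.id A) δ h.1 h.2)
    fun a => fst_dualHom _ _ _ _ a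
  exact ⟨D, funext fun a => (hD a).trans (snd_dualHom _ _ _ _ a)⟩

lemma Derivation.isDerivationFn {A : Type*} [CommRing A] [Algebra ℤ A] (D : Derivation ℤ A A) :
    IsDerivationFn D :=
  ⟨map_add D, fun a b => by simp⟩

lemma exists_shift_derivation {R : Type*} [CommRing R] (d : Derivation ℤ R R) (m : ℕ) :
    ∃ D : Derivation ℤ (MvPolynomial ℕ R) (MvPolynomial ℕ R),
      (∀ r, D (C r) = C (d r)) ∧ ∀ N, D (X N) = X (N + m) := by
  let E : MvPolynomial ℕ R →+* TrivSqZeroExt (MvPolynomial ℕ R) (MvPolynomial ℕ R) :=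
    eval₂Hom (dualHom C (fun r => C (d r)) (by simp) (by simp))
      fun N => TrivSqZeroExt.inl (X N) + TrivSqZeroExt.inr (X (N + m))
  obtain ⟨D, hD⟩ := exists_derivation_of_section E fun F => by
    induction F using MvPolynomial.induction_on with
    | C r => simp [E, fst_dualHom]
    | add p q hp hq => rw [map_add, TrivSqZeroExt.fst_add, hp, hq]
    | mul_X p N hp => rw [map_mul, TrivSqZeroExt.fst_mul, hp]; simp [E]
  exact ⟨D, fun r => by rw [hD]; simp [E, snd_dualHom], fun N => by rw [hD]; simp [E]⟩

lemma exists_derivation_fractionRing {A : Type*} [CommRing A] [Algebra ℤ A] [IsDomain A] (d : Derivation ℤ A A) :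
    ∃ D : Derivation ℤ (FractionRing A) (FractionRing A),
      ∀ a, D (algebraMap A (FractionRing A) a) = algebraMap A (FractionRing A) (d a) := by
  let e : A →+* TrivSqZeroExt (FractionRing A) (FractionRing A) :=
    dualHom (algebraMap A (FractionRing A)) (fun a => algebraMap A _ (d a)) (by simp) (by simp)
  have he : ∀ y : nonZeroDivisors A, IsUnit (e y) := fun y => by
    rw [TrivSqZeroExt.isUnit_iff_isUnit_fst, fst_dualHom]
    exact IsLocalization.map_units _ y
  obtain ⟨D, hD⟩ := exists_derivation_of_section (IsLocalization.lift (M := nonZeroDivisors A) he)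
    fun a => by
      have : (TrivSqZeroExt.fstHom (FractionRing A) (FractionRing A) (FractionRing A) :
          _ →+* FractionRing A).comp (IsLocalization.lift (M := nonZeroDivisors A) he) =
          RingHom.id _ := by
        refine IsLocalization.ringHom_ext (nonZeroDivisors A) (RingHom.ext fun a => ?_)
        simp [e, fst_dualHom]
      exact RingHom.congr_fun this a
  exact ⟨D, fun a => by rw [hD, IsLocalization.lift_eq, snd_dualHom]⟩

lemma exists_derivation_quotient {A : Type*} [CommRing A] (I : Ideal A) (d : Derivation ℤ A A)
    (hd : ∀ a ∈ I, d a ∈ I) : ∃ D : Derivation ℤ (A ⧸ I) (A ⧸ I),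
      ∀ a, D (Ideal.Quotient.mk I a) = Ideal.Quotient.mk I (d a) := by
  have hs : Function.Surjective (Ideal.Quotient.mk I).toIntAlgHom := Ideal.Quotient.mk_surjective
  exact ⟨Derivation.liftOfSurjective hs (d := d) fun x hx =>
    Ideal.Quotient.eq_zero_iff_mem.2 (hd x (Ideal.Quotient.eq_zero_iff_mem.1 hx)),
    fun a => Derivation.liftOfSurjective_apply hs _ a⟩

lemma isAlgClosed_of_diffClosedField.{v} {K : Type v} [Field K] [CharZero K] {δ : K → K}
    (hK : DiffClosedField K δ) : IsAlgClosed K := by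
  obtain ⟨d, hd⟩ := exists_derivation_of_isDerivationFn hK.1
  let : Differential K := ⟨d⟩
  refine IsAlgClosed.of_exists_root K fun p hp hpi => ?_
  have : Fact (Irreducible p) := ⟨hpi⟩
  have : Fact p.Monic := ⟨hp⟩
  obtain ⟨a, ha, -⟩ := hK.2 1 1 (fun _ => Polynomial.aeval (X (0, 0)) p) 1
    ⟨AdjoinRoot p, inferInstance, algebraMap K (AdjoinRoot p), Differential.deriv,
      Derivation.isDerivationFn _, fun x => by
        rw [DifferentialAlgebra.deriv_algebraMap, ← hd]; rfl, fun _ => AdjoinRoot.root p,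
      fun _ => by
        rw [devalMap, ← coe_eval₂Hom, Polynomial.aeval_def, Polynomial.hom_eval₂]
        simp [AdjoinRoot.algebraMap_eq], by simp [devalMap]⟩
  refine ⟨a 0, ?_⟩
  have := ha 0
  rw [devalMap, ← coe_eval₂Hom, Polynomial.aeval_def, Polynomial.hom_eval₂] at this
  simpa using this

end Derivations

section Topologies

variable {K : Type*} [Field K] {σ : Type*}

lemma mem_closure_zariskiTopology_iff {Y : Set (σ → K)} {x : σ → K} :
    x ∈ @closure _ (zariskiTopology K σ) Y ↔
      ∀ G : MvPolynomial σ K, eval x G ≠ 0 → ∃ y ∈ Y, eval y G ≠ 0 := by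
  let := zariskiTopology K σ
  have hb : TopologicalSpace.IsTopologicalBasis
      {U : Set (σ → K) | ∃ f : MvPolynomial σ K, U = {x | eval x f ≠ 0}} := by
    refine ⟨?_, ?_, rfl⟩
    · rintro _ ⟨f, rfl⟩ _ ⟨g, rfl⟩ x ⟨hf, hg⟩
      exact ⟨_, ⟨f * g, rfl⟩, by simpa using ⟨hf, hg⟩, fun y hy => by simpa using hy⟩
    · exact Set.eq_univ_of_forall fun x => ⟨_, ⟨1, rfl⟩, by simp⟩
  rw [hb.mem_closure_iff]
  constructor
  · rintro h G hG
    obtain ⟨y, hy, hyY⟩ := h _ ⟨G, rfl⟩ hG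
    exact ⟨y, hyY, hy⟩
  · rintro h _ ⟨G, rfl⟩ hG
    obtain ⟨y, hyY, hy⟩ := h G hG
    exact ⟨y, hy, hyY⟩

lemma closure_zariskiTopology_subset {ι : Type*} (f : ι → MvPolynomial σ K) {Y : Set (σ → K)}
    (hY : Y ⊆ {x | ∀ i, eval x (f i) = 0}) :
    @closure _ (zariskiTopology K σ) Y ⊆ {x | ∀ i, eval x (f i) = 0} := by
  intro x hx i
  by_contra h
  obtain ⟨y, hy, hy'⟩ := mem_closure_zariskiTopology_iff.1 hx (f i) h
  exact hy' (hY hy i)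

lemma isClosed_kolchinTopology (δ : K → K) (f : MvPolynomial (σ × ℕ) K) :
    @IsClosed _ (kolchinTopology K δ σ) {a | devalMap (RingHom.id K) δ f a = 0} := by
  let := kolchinTopology K δ σ
  exact ⟨TopologicalSpace.isOpen_generateFrom_of_mem ⟨f, rfl⟩⟩

end Topologies

section Points

variable {R L : Type*} [CommRing R] [CommRing L] {n : ℕ}

/-- The homomorphism sending the variable with index `j * (n + 1) + i` to the `j`-th derivative of
the `i`-th coordinate of a point (and to zero when `i = n`). -/
noncomputable def pointHom (ι : R →+* L) (δ : L → L) (a : Fin n → L) : MvPolynomial ℕ R →+* L :=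
  eval₂Hom ι fun N => if h : N % (n + 1) < n then δ^[N / (n + 1)] (a ⟨N % (n + 1), h⟩) else 0

/-- The index of the variable standing for the `j`-th derivative of the `i`-th coordinate. -/
def jetIndex (n h : ℕ) (p : Fin n × Fin (h + 1)) : ℕ := p.1 + p.2 * (n + 1)

lemma pointHom_C (ι : R →+* L) (δ : L → L) (a : Fin n → L) (r : R) :
    pointHom ι δ a (C r) = ι r := by simp [pointHom]

lemma pointHom_X (ι : R →+* L) (δ : L → L) (a : Fin n → L) (i : Fin n) (j : ℕ) :
    pointHom ι δ a (X (i + j * (n + 1))) = δ^[j] (a i) := by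
  have hi : (i : ℕ) < n + 1 := i.2.trans (Nat.lt_succ_self n)
  have h1 : ((i : ℕ) + j * (n + 1)) % (n + 1) = i := by
    rw [Nat.add_mul_mod_self_right, Nat.mod_eq_of_lt hi]
  have h2 : ((i : ℕ) + j * (n + 1)) / (n + 1) = j := by
    rw [Nat.add_mul_div_right _ _ (Nat.succ_pos n), Nat.div_eq_of_lt hi, zero_add]
  simp [pointHom, h1, h2]

lemma pointHom_derivation {ι : R →+* L} {δ : L → L} (hδ : IsDerivationFn δ) {d : R → R}
    (hd : ∀ r, ι (d r) = δ (ι r)) {D : Derivation ℤ (MvPolynomial ℕ R) (MvPolynomial ℕ R)}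
    (hDC : ∀ r, D (C r) = C (d r)) (hDX : ∀ N, D (X N) = X (N + (n + 1))) (a : Fin n → L)
    (F : MvPolynomial ℕ R) : pointHom ι δ a (D F) = δ (pointHom ι δ a F) := by
  have h0 : δ 0 = 0 := by simpa using hδ.1 0 0
  have hX : ∀ N, pointHom ι δ a (D (X N)) = δ (pointHom ι δ a (X N)) := fun N => by
    rw [hDX]
    by_cases h : N % (n + 1) < n
    · simp [pointHom, h, Function.iterate_succ_apply', Nat.add_div_right]
    · simp [pointHom, h, h0]
  induction F using MvPolynomial.induction_on with
  | C r => rw [hDC, pointHom_C, pointHom_C, hd]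
  | add p q hp hq => rw [map_add, map_add, map_add, hδ.1, hp, hq]
  | mul_X p N hp =>
    rw [Derivation.leibniz, map_mul, hδ.2, map_add, smul_eq_mul, smul_eq_mul, map_mul, map_mul, hp,
      hX]

lemma pointHom_rename (ι : R →+* L) (δ : L → L) (a : Fin n → L) (h : ℕ)
    (F : MvPolynomial (Fin n × Fin (h + 1)) R) :
    pointHom ι δ a (rename (jetIndex n h) F) = eval₂ ι (nablaMap δ n h a) F := by
  rw [← coe_eval₂Hom]
  change ((pointHom ι δ a).comp (rename (jetIndex n h)).toRingHom) F = _
  congr 1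
  refine MvPolynomial.ringHom_ext (fun r => ?_) fun p => ?_
  · simp [pointHom_C]
  · simp [jetIndex, pointHom_X, nablaMap]

lemma iterate_derivation_X {D : Derivation ℤ (MvPolynomial ℕ R) (MvPolynomial ℕ R)} {m : ℕ}
    (hDX : ∀ N, D (X N) = X (N + m)) (N j : ℕ) : D^[j] (X N) = X (N + j * m) := by
  induction j with
  | zero => simp
  | succ j ih => rw [Function.iterate_succ_apply', ih, hDX, Nat.succ_mul, add_assoc]

end Points

section Comparison

variable {R K : Type u} [CommRing R] [Field K] [Algebra R K] {n h s : ℕ}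

lemma not_isNilpotent_of_map_ne_zero {A B : Type*} [CommRing A] [CommRing B] [IsReduced B]
    (f : A →+* B) {z : A} (hz : f z ≠ 0) : ¬ IsNilpotent z :=
  fun h => hz (h.map f).eq_zero

/-- The canonical map from a polynomial ring to the base change of a quotient. -/
noncomputable def baseChangeHom (L : Type*) [Field L] [Algebra R L] {σ : Type*}
    (J : Ideal (MvPolynomial σ R)) :
    MvPolynomial σ L →ₐ[L] L ⊗[R] (MvPolynomial σ R ⧸ J) :=
  aeval fun p => (1 : L) ⊗ₜ[R] Ideal.Quotient.mk J (X p)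

lemma baseChangeHom_map {σ : Type*} (J : Ideal (MvPolynomial σ R)) (F : MvPolynomial σ R) :
    baseChangeHom K J (map (algebraMap R K) F) = 1 ⊗ₜ Ideal.Quotient.mk J F := by
  have : ((baseChangeHom K J).restrictScalars R).comp (mapAlgHom (Algebra.ofId R K)) =
      (Algebra.TensorProduct.includeRight.comp (Ideal.Quotient.mkₐ R J)) := by
    ext p
    simp [baseChangeHom]
  exact DFunLike.congr_fun this F

lemma baseChangeHom_surjective {σ : Type*} (J : Ideal (MvPolynomial σ R)) :
    Function.Surjective (baseChangeHom K J) := by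
  intro z
  induction z with
  | zero => exact ⟨0, map_zero _⟩
  | add x y hx hy =>
    obtain ⟨F, rfl⟩ := hx
    obtain ⟨G, rfl⟩ := hy
    exact ⟨F + G, map_add _ _ _⟩
  | tmul c t =>
    obtain ⟨F, rfl⟩ := Ideal.Quotient.mk_surjective t
    refine ⟨c • map (algebraMap R K) F, ?_⟩
    rw [map_smul, baseChangeHom_map, TensorProduct.smul_tmul', smul_eq_mul, mul_one]

variable {δ : K → K} {d : Derivation ℤ R R}
  {D : Derivation ℤ (MvPolynomial ℕ R) (MvPolynomial ℕ R)}
  {g : Fin s → MvPolynomial (Fin n × Fin (h + 1)) R}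
  {J : Ideal (MvPolynomial ℕ R)}
  {θ : (MvPolynomial (Fin n × Fin (h + 1)) R ⧸ Ideal.span (Set.range g)) →ₐ[R]
    (MvPolynomial ℕ R ⧸ J)}

lemma hasNilKernelAt_of_subset_closure [IsAlgClosed K] (hδ : IsDerivationFn δ)
    (hd : ∀ r, algebraMap R K (d r) = δ (algebraMap R K r))
    (hDC : ∀ r, D (C r) = C (d r)) (hDX : ∀ N, D (X N) = X (N + (n + 1)))
    (hJ : J = Ideal.span {F | ∃ k i, F = D^[k] (rename (jetIndex n h) (g i))})
    (hθ : ∀ F, θ (Ideal.Quotient.mk _ F) = Ideal.Quotient.mk _ (rename (jetIndex n h) F))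
    (hV : {x : Fin n × Fin (h + 1) → K | ∀ i, aeval x (g i) = 0} ⊆
      @closure _ (zariskiTopology K _) ({x | ∀ i, aeval x (g i) = 0} ∩
        Set.range (nablaMap δ n h))) :
    HasNilKernelAt θ K := by
  intro z hz
  by_contra hnil
  obtain ⟨χ, hχ⟩ := exists_algHom_ne_zero K _ hnil
  obtain ⟨G, rfl⟩ := baseChangeHom_surjective _ z
  let x₀ : Fin n × Fin (h + 1) → K := fun p => χ (baseChangeHom K (Ideal.span (Set.range g)) (X p))
  have hx₀ : ∀ F, χ (baseChangeHom K (Ideal.span (Set.range g)) F) = eval x₀ F := by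
    intro F
    have : χ.comp (baseChangeHom K _) = aeval x₀ := by
      ext p
      simp [x₀]
    rw [← coe_aeval_eq_eval, ← this]
    rfl
  obtain ⟨_, ⟨hyV, a, rfl⟩, hy⟩ := mem_closure_zariskiTopology_iff.1 (hV (a := x₀) fun i => by
    have := hx₀ (map (algebraMap R K) (g i))
    rw [baseChangeHom_map, Ideal.Quotient.eq_zero_iff_mem.2 (Ideal.subset_span (Set.mem_range_self i)),
      tmul_zero, map_zero, eval_map] at this
    exact this.symm) G (by rwa [← hx₀])
  have h0 : δ 0 = 0 := by simpa using hδ.1 0 0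
  let Ψ : MvPolynomial ℕ R →ₐ[R] K :=
    { pointHom (algebraMap R K) δ a with commutes' := fun r => pointHom_C _ _ _ _ }
  have hΨ : ∀ F ∈ J, Ψ F = 0 := by
    intro F hF
    suffices J ≤ RingHom.ker Ψ from this hF
    rw [hJ, Ideal.span_le]
    rintro _ ⟨k, i, rfl⟩
    change pointHom (algebraMap R K) δ a _ = 0
    have hsc : Function.Semiconj (pointHom (algebraMap R K) δ a) D δ :=
      fun F => pointHom_derivation hδ hd hDC hDX a F
    rw [(hsc.iterate_right k).eq, pointHom_rename]
    have : eval₂ (algebraMap R K) (nablaMap δ n h a) (g i) = 0 := hyV i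
    rw [this]
    exact Function.iterate_fixed h0 k
  let ΨU := Ideal.Quotient.liftₐ J Ψ hΨ
  let Λ : K ⊗[R] (MvPolynomial ℕ R ⧸ J) →ₐ[K] K :=
    Algebra.TensorProduct.lift (AlgHom.id K K) ΨU fun _ _ => Commute.all _ _
  have hΛ : (Λ.comp (Algebra.TensorProduct.map (AlgHom.id K K) θ)).comp (baseChangeHom K _) =
      aeval (nablaMap δ n h a) := by
    ext p
    simp only [baseChangeHom, AlgHom.comp_apply, aeval_X, Algebra.TensorProduct.map_tmul, hθ, Λ,
      Algebra.TensorProduct.lift_tmul, map_one, one_mul, rename_X]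
    change pointHom (algebraMap R K) δ a (X (jetIndex n h p)) = _
    rw [jetIndex, pointHom_X]
    rfl
  refine hy ?_
  rw [← coe_aeval_eq_eval, ← hΛ]
  exact (congrArg Λ hz).trans (map_zero Λ)

lemma subset_closure_of_hasNilKernelAt [CharZero K] (hK : DiffClosedField K δ)
    (hd : ∀ r, algebraMap R K (d r) = δ (algebraMap R K r))
    (hDC : ∀ r, D (C r) = C (d r)) (hDX : ∀ N, D (X N) = X (N + (n + 1)))
    (hJ : ∀ i, rename (jetIndex n h) (g i) ∈ J)
    (hθ : ∀ F, θ (Ideal.Quotient.mk _ F) = Ideal.Quotient.mk _ (rename (jetIndex n h) F))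
    {δU : MvPolynomial ℕ R ⧸ J → MvPolynomial ℕ R ⧸ J} (hδ : IsDerivationFn δU)
    (hδU : ∀ F, δU (Ideal.Quotient.mk J F) = Ideal.Quotient.mk J (D F))
    (hnil : HasNilKernelAt θ K) :
    {x : Fin n × Fin (h + 1) → K | ∀ i, aeval x (g i) = 0} ⊆
      @closure _ (zariskiTopology K _) ({x | ∀ i, aeval x (g i) = 0} ∩
        Set.range (nablaMap δ n h)) := by
  intro x₀ hx₀
  rw [mem_closure_zariskiTopology_iff]
  intro G hG
  obtain ⟨dK, rfl⟩ := exists_derivation_of_isDerivationFn hK.1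
  obtain ⟨δU, rfl⟩ := exists_derivation_of_isDerivationFn hδ
  let μ := Algebra.TensorProduct.map (AlgHom.id K K) θ
  let z := baseChangeHom K (Ideal.span (Set.range g)) G
  have hz : ¬ IsNilpotent z := by
    let χ₀ : K ⊗[R] (MvPolynomial (Fin n × Fin (h + 1)) R ⧸ Ideal.span (Set.range g)) →ₐ[K] K :=
      Algebra.TensorProduct.lift (AlgHom.id K K) (Ideal.Quotient.liftₐ _ (aeval x₀) fun F hF => by
        suffices Ideal.span (Set.range g) ≤ RingHom.ker (aeval x₀ : _ →ₐ[R] K) from this hF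
        rw [Ideal.span_le]
        rintro _ ⟨i, rfl⟩
        exact hx₀ i) fun _ _ => Commute.all _ _
    have : χ₀.comp (baseChangeHom K _) = aeval x₀ := by
      ext p
      simp only [baseChangeHom, AlgHom.comp_apply, aeval_X, χ₀, Algebra.TensorProduct.lift_tmul,
        map_one, one_mul]
      exact aeval_X _ _
    refine not_isNilpotent_of_map_ne_zero (B := K) (A := K ⊗[R]
      (MvPolynomial (Fin n × Fin (h + 1)) R ⧸ Ideal.span (Set.range g))) χ₀.toRingHom fun h0 => hG ?_
    rw [← coe_aeval_eq_eval, ← this]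
    exact h0
  have hμz : ¬ IsNilpotent (μ z) := by
    rintro ⟨N, hN⟩
    rw [← map_pow] at hN
    obtain ⟨M, hM⟩ := hnil _ hN
    exact hz ⟨N * M, by rw [pow_mul, hM]⟩
  obtain ⟨k, _, _, χ, hχ⟩ := exists_ringHom_algClosed_ne_zero
    (T := K ⊗[R] (MvPolynomial ℕ R ⧸ J)) hμz
  let ψ : (MvPolynomial ℕ R ⧸ J) →+* k :=
    χ.comp (Algebra.TensorProduct.includeRight : _ →ₐ[R] K ⊗[R] _).toRingHom
  let κ : K →+* k := χ.comp (algebraMap K _)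
  have : CharZero k := charZero_of_injective_ringHom κ.injective
  let τU := taylorHom δU ψ
  let τK := taylorHom dK κ
  have hτ : ∀ r : R, τU (Ideal.Quotient.mk J (C r)) = τK (algebraMap R K r) := by
    intro r
    refine taylorHom_congr _ _ _ _ fun N => ?_
    have h1 : Function.Semiconj (fun r => Ideal.Quotient.mk J (C r)) d δU :=
      fun r => by rw [hδU, hDC]
    have h2 : Function.Semiconj (algebraMap R K) d dK := hd
    rw [← (h1.iterate_right N).eq, ← (h2.iterate_right N).eq]
    change χ (1 ⊗ₜ algebraMap R _ _) = χ (algebraMap R K _ ⊗ₜ 1)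
    rw [Algebra.algebraMap_eq_smul_one, Algebra.algebraMap_eq_smul_one, TensorProduct.smul_tmul]
  obtain ⟨DL, hDL⟩ := exists_derivation_fractionRing
    ((PowerSeries.derivative k).restrictScalars ℤ : Derivation ℤ (PowerSeries k) (PowerSeries k))
  let j := algebraMap (PowerSeries k) (FractionRing (PowerSeries k))
  have hj : Function.Injective j := IsFractionRing.injective _ _
  let b : Fin n → FractionRing (PowerSeries k) := fun i => j (τU (Ideal.Quotient.mk J (X i)))
  have hsU : Function.Semiconj (fun F => j (τU (Ideal.Quotient.mk J F))) D DL := fun F => by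
    refine .trans ?_ (hDL _).symm
    refine congrArg j ((congrArg τU (hδU F).symm).trans ?_)
    exact (derivative_taylorHom _ _ _).symm
  have hb : ∀ p : Fin n × Fin (h + 1),
      DL^[p.2] (b p.1) = j (τU (Ideal.Quotient.mk J (X (jetIndex n h p)))) := by
    intro p
    rw [jetIndex, ← iterate_derivation_X hDX]
    exact ((hsU.iterate_right p.2).eq _).symm
  let pr : Fin n × Fin (h + 1) → Fin n × ℕ := fun p => (p.1, p.2)
  have heval : ∀ H : MvPolynomial (Fin n × Fin (h + 1)) K,
      devalMap (j.comp τK) DL (rename pr H) b =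
        j (eval₂ τK (fun p => τU (Ideal.Quotient.mk J (X (jetIndex n h p)))) H) := by
    intro H
    rw [devalMap, eval₂_rename, hom_eval₂]
    congr 1
    exact funext hb
  obtain ⟨a, ha, ha'⟩ := hK.2 n s (fun i => rename pr (map (algebraMap R K) (g i))) (rename pr G)
    ⟨FractionRing (PowerSeries k), inferInstance, j.comp τK, DL, Derivation.isDerivationFn DL,
      fun x => (congrArg j (derivative_taylorHom _ _ _).symm).trans (hDL _).symm, b, fun i => by
        rw [heval, eval₂_map]
        have : (τU.comp (Ideal.Quotient.mk J)).comp (rename (jetIndex n h)).toRingHom =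
            eval₂Hom (τK.comp (algebraMap R K))
              fun p => τU (Ideal.Quotient.mk J (X (jetIndex n h p))) := by
          refine MvPolynomial.ringHom_ext (fun r => ?_) fun p => ?_
          · simp [hτ]
          · simp
        rw [← coe_eval₂Hom, ← this]
        change j (τU (Ideal.Quotient.mk J (rename (jetIndex n h) (g i)))) = 0
        rw [Ideal.Quotient.eq_zero_iff_mem.2 (hJ i), map_zero, map_zero], by
        rw [heval]
        refine (map_ne_zero_iff j hj).2 fun h0 => hχ ?_
        have hc := congrArg (PowerSeries.constantCoeff (R := k)) h0
        rw [map_zero, hom_eval₂] at hc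
        rw [← hc, ← coe_eval₂Hom]
        change (χ.comp (μ.toRingHom.comp (baseChangeHom K _).toRingHom)) G = _
        congr 1
        refine MvPolynomial.ringHom_ext (fun r => ?_) fun p => ?_
        · simp [τK, constantCoeff_taylorHom, κ, μ]
        · simp [τU, constantCoeff_taylorHom, ψ, baseChangeHom, μ, hθ]⟩
  have hpr : ∀ H : MvPolynomial (Fin n × Fin (h + 1)) K,
      devalMap (RingHom.id K) dK (rename pr H) a = eval (nablaMap dK n h a) H := by
    intro H
    rw [devalMap, eval₂_rename]
    rfl
  refine ⟨nablaMap dK n h a, ⟨fun i => ?_, a, rfl⟩, by rwa [← hpr]⟩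
  have := ha i
  rwa [hpr, eval_map] at this

end Comparison

section Definability

lemma Derivation.map_mem_span {A : Type*} [CommRing A] [Algebra ℤ A] (D : Derivation ℤ A A)
    {s : Set A} (hs : ∀ a ∈ s, D a ∈ Ideal.span s) {a : A} (ha : a ∈ Ideal.span s) :
    D a ∈ Ideal.span s := by
  induction ha using Submodule.span_induction with
  | mem a ha => exact hs a ha
  | zero => rw [map_zero]; exact zero_mem _
  | add a b _ _ hD hD' => rw [map_add]; exact add_mem hD hD'
  | smul r a ha hD =>
    rw [smul_eq_mul, Derivation.leibniz, smul_eq_mul, smul_eq_mul]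
    exact add_mem (Ideal.mul_mem_left _ _ hD) (Ideal.mul_mem_right _ _ ha)

lemma exists_differential_prime_of_ultrafilter {α S k : Type*} [CommRing S] [Field k]
    (φ : α → S →+* k) (D : S → S) (hD : ∀ a F, φ a F = 0 → φ a (D F) = 0) (𝒰 : Ultrafilter α) :
    ∃ P : Ideal S, P.IsPrime ∧ (∀ F ∈ P, D F ∈ P) ∧ ∀ F, F ∈ P ↔ ∀ᶠ a in 𝒰, φ a F = 0 := by
  refine ⟨⟨⟨⟨{F | ∀ᶠ a in 𝒰, φ a F = 0}, fun {F G} hF hG => ?_⟩, ?_⟩, fun G {F} hF => ?_⟩,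
    ⟨?_, fun {F G} hFG => ?_⟩, fun F hF => ?_, fun F => Iff.rfl⟩
  · filter_upwards [hF, hG] with a h h'
    rw [map_add, h, h', add_zero]
  · exact Filter.Eventually.of_forall fun a => map_zero _
  · filter_upwards [hF] with a h
    rw [smul_eq_mul, map_mul, h, mul_zero]
  · rw [Ideal.ne_top_iff_one]
    intro h
    obtain ⟨a, ha⟩ := Filter.Eventually.exists (f := (𝒰 : Filter α)) h
    exact one_ne_zero ((map_one (φ a)).symm.trans ha)
  · refine Ultrafilter.eventually_or.1 (Filter.Eventually.mono (f := (𝒰 : Filter α)) hFG fun a h => ?_)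
    rwa [map_mul, mul_eq_zero] at h
  · exact Filter.Eventually.mono (f := (𝒰 : Filter α)) hF fun a h => hD a F h

lemma pointHom_eq_devalMap {K : Type*} [Field K] (δ : K → K) {q : ℕ} (F : MvPolynomial ℕ K) :
    ∃ F' : MvPolynomial (Fin q × ℕ) K, ∀ b : Fin q → K,
      pointHom (RingHom.id K) δ b F = devalMap (RingHom.id K) δ F' b := by
  refine ⟨aeval (fun N => if h : N % (q + 1) < q then X (⟨N % (q + 1), h⟩, N / (q + 1)) else 0) F,
    fun b => ?_⟩
  rw [devalMap, ← coe_eval₂Hom]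
  change _ = (RingHom.comp (eval₂Hom _ _) (aeval _).toRingHom) F
  congr 1
  refine MvPolynomial.ringHom_ext (fun r => ?_) fun N => ?_
  · simp [pointHom]
  · by_cases h : N % (q + 1) < q <;> simp [pointHom, h]

/-- The parameters for which the fibre of a family is the closure of its differential points. -/
def admissibleSet {K : Type*} [Field K] (δ : K → K) {n h q s : ℕ}
    (f : Fin s → MvPolynomial (Fin q ⊕ Fin n × Fin (h + 1)) K) : Set (Fin q → K) :=
  {b | {x : Fin n × Fin (h + 1) → K | ∀ i, eval (Sum.elim b x) (f i) = 0} =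
    @closure _ (zariskiTopology K (Fin n × Fin (h + 1)))
      ({x : Fin n × Fin (h + 1) → K | ∀ i, eval (Sum.elim b x) (f i) = 0} ∩
        Set.range (nablaMap δ n h))}

lemma exists_ne_zero_eq_closure_or {R : Type u} [CommRing R] [IsDomain R] [CharZero R]
    (d : Derivation ℤ R R) {n h s : ℕ} (g : Fin s → MvPolynomial (Fin n × Fin (h + 1)) R)
    {K : Type u} [Field K] [CharZero K] {δ : K → K} (hK : DiffClosedField K δ) :
    ∃ e : R, e ≠ 0 ∧ ∃ p : Prop, ∀ [Algebra R K], (∀ r, algebraMap R K (d r) = δ (algebraMap R K r)) →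
      algebraMap R K e ≠ 0 → (p ↔ {x : Fin n × Fin (h + 1) → K | ∀ i, aeval x (g i) = 0} =
        @closure _ (zariskiTopology K (Fin n × Fin (h + 1)))
          ({x | ∀ i, aeval x (g i) = 0} ∩ Set.range (nablaMap δ n h))) := by
  have hclosed := isAlgClosed_of_diffClosedField hK
  obtain ⟨E, hEC, hEX⟩ := exists_shift_derivation d (n + 1)
  let J : Ideal (MvPolynomial ℕ R) :=
    Ideal.span {F | ∃ k i, F = E^[k] (rename (jetIndex n h) (g i))}
  have hgJ : ∀ i, rename (jetIndex n h) (g i) ∈ J := fun i => Ideal.subset_span ⟨0, i, rfl⟩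
  obtain ⟨δU, hδU⟩ := exists_derivation_quotient J E fun F hF => by
    refine E.map_mem_span ?_ hF
    rintro _ ⟨k, i, rfl⟩
    exact Ideal.subset_span ⟨k + 1, i, (Function.iterate_succ_apply' _ _ _).symm⟩
  let θ : (MvPolynomial (Fin n × Fin (h + 1)) R ⧸ Ideal.span (Set.range g)) →ₐ[R]
      (MvPolynomial ℕ R ⧸ J) :=
    Ideal.Quotient.liftₐ _ ((Ideal.Quotient.mkₐ R J).comp (rename (jetIndex n h))) fun F hF => by
      suffices Ideal.span (Set.range g) ≤
        RingHom.ker ((Ideal.Quotient.mkₐ R J).comp (rename (jetIndex n h))) from this hF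
      rw [Ideal.span_le]
      rintro _ ⟨i, rfl⟩
      exact Ideal.Quotient.eq_zero_iff_mem.2 (hgJ i)
  have hθ : ∀ F, θ (Ideal.Quotient.mk _ F) = Ideal.Quotient.mk _ (rename (jetIndex n h) F) :=
    fun F => rfl
  obtain ⟨e, he, htruth⟩ := exists_ne_zero_hasNilKernelAt_or (Nat.succ_pos n)
    (D := E) ⟨fun r => ⟨_, hEC r⟩, hEX⟩ δU (Ideal.Quotient.mkₐ R J)
    (Ideal.Quotient.mkₐ_surjective R J) (fun F => (hδU F).symm) θ
  have hiff : ∀ [Algebra R K], (∀ r, algebraMap R K (d r) = δ (algebraMap R K r)) →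
      (HasNilKernelAt θ K ↔ {x : Fin n × Fin (h + 1) → K | ∀ i, aeval x (g i) = 0} =
        @closure _ (zariskiTopology K (Fin n × Fin (h + 1)))
          ({x | ∀ i, aeval x (g i) = 0} ∩ Set.range (nablaMap δ n h))) := by
    intro _ hd
    constructor
    · intro hnil
      refine (subset_closure_of_hasNilKernelAt hK hd hEC hEX hgJ hθ
        (Derivation.isDerivationFn δU) hδU hnil).antisymm ?_
      have := closure_zariskiTopology_subset (fun i => map (algebraMap R K) (g i))
        (Y := {x | ∀ i, aeval x (g i) = 0} ∩ Set.range (nablaMap δ n h)) fun x hx i => by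
          rw [eval_map]
          exact hx.1 i
      simp only [eval_map] at this
      exact this
    · intro H
      exact hasNilKernelAt_of_subset_closure hK.1 hd hEC hEX rfl hθ H.subset
  rcases htruth with H | H
  · exact ⟨e, he, True, fun hd hek => (iff_of_true trivial ((hiff hd).1 (H K hek)))⟩
  · exact ⟨e, he, False, fun hd hek => (iff_of_false id fun h3 => H K hek ((hiff hd).2 h3))⟩

lemma exists_cell_of_differential_prime {K : Type u} [Field K] [CharZero K] {δ : K → K}
    (hK : DiffClosedField K δ) {n h q s : ℕ}
    (f : Fin s → MvPolynomial (Fin q ⊕ Fin n × Fin (h + 1)) K) {d : Derivation ℤ K K} (hd : ⇑d = δ)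
    {D : Derivation ℤ (MvPolynomial ℕ K) (MvPolynomial ℕ K)} (hDC : ∀ r, D (C r) = C (d r))
    (hDX : ∀ N, D (X N) = X (N + (q + 1))) (P : Ideal (MvPolynomial ℕ K)) [P.IsPrime]
    (hP : ∀ F ∈ P, D F ∈ P) :
    ∃ (F₀ : Finset (MvPolynomial ℕ K)) (t : MvPolynomial ℕ K), (∀ F ∈ F₀, F ∈ P) ∧ t ∉ P ∧
      ∃ p : Prop, ∀ b : Fin q → K, (∀ F ∈ F₀, pointHom (RingHom.id K) δ b F = 0) →
        pointHom (RingHom.id K) δ b t ≠ 0 → (p ↔ b ∈ admissibleSet δ f) := by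
  have : CharZero (MvPolynomial ℕ K ⧸ P) :=
    charZero_of_injective_ringHom (algebraMap K (MvPolynomial ℕ K ⧸ P)).injective
  obtain ⟨dR, hdR⟩ := exists_derivation_quotient P D hP
  let γ : MvPolynomial (Fin q ⊕ Fin n × Fin (h + 1)) K →+*
      MvPolynomial (Fin n × Fin (h + 1)) (MvPolynomial ℕ K ⧸ P) :=
    eval₂Hom (C.comp (algebraMap K _))
      (Sum.elim (fun j => C (Ideal.Quotient.mk P (X j))) X)
  obtain ⟨e, he, p, htruth⟩ := exists_ne_zero_eq_closure_or dR (fun i => γ (f i)) hK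
  obtain ⟨e, rfl⟩ := Ideal.Quotient.mk_surjective e
  obtain ⟨F₀, t, hF₀, ht, hdet⟩ := exists_finite_determination.{u} (Nat.succ_pos q)
    (D := D) ⟨fun r => ⟨_, hDC r⟩, hDX⟩ (Ideal.Quotient.mk P) fun F hF =>
      Ideal.Quotient.eq_zero_iff_mem.2 (hP F (Ideal.Quotient.eq_zero_iff_mem.1 hF))
  have h0 : δ 0 = 0 := by rw [← hd, map_zero]
  refine ⟨F₀, t * e, fun F hF => Ideal.Quotient.eq_zero_iff_mem.1 (hF₀ F hF), ?_, p, ?_⟩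
  · rw [← Ideal.Quotient.eq_zero_iff_mem, map_mul]
    exact mul_ne_zero ht he
  intro b hb hbt
  rw [map_mul] at hbt
  have hφ : ∀ F, pointHom (RingHom.id K) δ b (D F) = δ (pointHom (RingHom.id K) δ b F) :=
    pointHom_derivation hK.1 (d := d) (fun r => by rw [hd]; rfl) hDC hDX b
  have hker := hdet K (pointHom (RingHom.id K) δ b) (fun F hF => by rw [hφ, hF, h0]) hb
    (left_ne_zero_of_mul hbt)
  let := (Ideal.Quotient.lift P (pointHom (RingHom.id K) δ b)
    fun F hF => hker F (Ideal.Quotient.eq_zero_iff_mem.2 hF)).toAlgebra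
  have hρ : ∀ F, algebraMap (MvPolynomial ℕ K ⧸ P) K (Ideal.Quotient.mk P F) =
      pointHom (RingHom.id K) δ b F := fun F => rfl
  have hV : ∀ x, eval (Sum.elim b x) = (aeval x).toRingHom.comp γ := by
    intro x
    refine MvPolynomial.ringHom_ext (fun r => ?_) ?_
    · have : algebraMap (MvPolynomial ℕ K ⧸ P) K (algebraMap K _ r) = r :=
        (hρ (C r)).trans (pointHom_C _ _ _ _)
      simp [γ, this]
    · rintro (j | p)
      · simpa [γ, hρ] using (pointHom_X (RingHom.id K) δ b j 0).symm
      · simp [γ]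
  rw [admissibleSet, Set.mem_ofPred_eq]
  simp only [hV]
  refine htruth (fun r => ?_) (by rw [hρ]; exact right_ne_zero_of_mul hbt)
  obtain ⟨F, rfl⟩ := Ideal.Quotient.mk_surjective r
  exact (congrArg _ (hdR F)).trans ((hρ _).trans (hφ F))

lemma isConstructibleIn_of_finset {α ι : Type*} {τ : TopologicalSpace α} (t : Finset ι)
    (C D : ι → Set α) (hC : ∀ i, IsClosed (C i)) (hD : ∀ i, IsClosed (D i)) :
    IsConstructibleIn τ (⋃ i ∈ t, C i \ D i) := by
  refine ⟨t.card, fun j => C (t.equivFin.symm j), fun j => D (t.equivFin.symm j), fun j => hC _,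
    fun j => hD _, ?_⟩
  rw [t.equivFin.symm.surjective.iUnion_comp fun i : t => C i \ D i]
  exact Set.biUnion_eq_iUnion (t : Set ι) fun i _ => C i \ D i

theorem isConstructibleIn_admissibleSet {K : Type u} [Field K] [CharZero K] {δ : K → K}
    (hK : DiffClosedField K δ) {n h q s : ℕ}
    (f : Fin s → MvPolynomial (Fin q ⊕ Fin n × Fin (h + 1)) K) :
    IsConstructibleIn (kolchinTopology K δ (Fin q)) (admissibleSet δ f) := by
  classical
  let := kolchinTopology K δ (Fin q)
  obtain ⟨d, hd⟩ := exists_derivation_of_isDerivationFn hK.1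
  obtain ⟨D, hDC, hDX⟩ := exists_shift_derivation d (q + 1)
  have hφ : ∀ (b : Fin q → K) F, pointHom (RingHom.id K) δ b (D F) =
      δ (pointHom (RingHom.id K) δ b F) := fun b =>
    pointHom_derivation hK.1 (d := d) (fun r => by rw [hd]; rfl) hDC hDX b
  have hcell : ∀ 𝒰 : Ultrafilter (Fin q → K), ∃ (F₀ : Finset (MvPolynomial ℕ K))
      (t : MvPolynomial ℕ K), {b | (∀ F ∈ F₀, pointHom (RingHom.id K) δ b F = 0) ∧
        pointHom (RingHom.id K) δ b t ≠ 0} ∈ 𝒰 ∧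
      ∃ p : Prop, ∀ b : Fin q → K, (∀ F ∈ F₀, pointHom (RingHom.id K) δ b F = 0) →
        pointHom (RingHom.id K) δ b t ≠ 0 → (p ↔ b ∈ admissibleSet δ f) := by
    intro 𝒰
    obtain ⟨P, _, hPD, hP⟩ := exists_differential_prime_of_ultrafilter
      (fun b : Fin q → K => pointHom (RingHom.id K) δ b) D
      (fun b F hF => by rw [hφ, hF, ← hd, map_zero]) 𝒰
    obtain ⟨F₀, t, hF₀, ht, H⟩ := exists_cell_of_differential_prime hK f hd hDC hDX P hPD
    refine ⟨F₀, t, ?_, H⟩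
    have h1 : ∀ᶠ b : Fin q → K in (𝒰 : Filter (Fin q → K)), ∀ F ∈ F₀,
        pointHom (RingHom.id K) δ b F = 0 :=
      (Filter.eventually_all_finset F₀).2 fun F hF => (hP F).1 (hF₀ F hF)
    have h2 : ∀ᶠ b : Fin q → K in (𝒰 : Filter (Fin q → K)), pointHom (RingHom.id K) δ b t ≠ 0 :=
      Ultrafilter.eventually_not.2 fun h => ht ((hP t).2 h)
    exact h1.and h2
  choose F₀ t hmem p H using hcell
  let Z : Ultrafilter (Fin q → K) → Set (Fin q → K) :=
    fun 𝒰 => {b | ∀ F ∈ F₀ 𝒰, pointHom (RingHom.id K) δ b F = 0}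
  let W : Ultrafilter (Fin q → K) → Set (Fin q → K) :=
    fun 𝒰 => {b | pointHom (RingHom.id K) δ b (t 𝒰) = 0}
  have hclosed : ∀ F, IsClosed {b : Fin q → K | pointHom (RingHom.id K) δ b F = 0} := by
    intro F
    obtain ⟨F', hF'⟩ := pointHom_eq_devalMap δ (q := q) F
    simp only [hF']
    exact isClosed_kolchinTopology δ F'
  have hZ : ∀ 𝒰, IsClosed (Z 𝒰) := by
    intro 𝒰
    have : Z 𝒰 = ⋂ F ∈ F₀ 𝒰, {b | pointHom (RingHom.id K) δ b F = 0} := by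
      ext b
      simp [Z]
    rw [this]
    exact isClosed_biInter fun F _ => hclosed F
  obtain ⟨S, hS⟩ := CompactSpace.elim_nhds_subcover
    (fun 𝒰 : Ultrafilter (Fin q → K) => {𝒱 : Ultrafilter (Fin q → K) | Z 𝒰 \ W 𝒰 ∈ 𝒱})
    fun 𝒰 => (ultrafilter_isOpen_basic _).mem_nhds (hmem 𝒰)
  have hcover : ∀ b, ∃ 𝒰 ∈ S, b ∈ Z 𝒰 \ W 𝒰 := by
    intro b
    have : (pure b : Ultrafilter (Fin q → K)) ∈ (⊤ : Set (Ultrafilter (Fin q → K))) := trivial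
    rw [← hS] at this
    simpa [and_left_comm] using this
  have heq : admissibleSet δ f =
      ⋃ 𝒰 ∈ S.filter fun 𝒰 => Z 𝒰 \ W 𝒰 ⊆ admissibleSet δ f, Z 𝒰 \ W 𝒰 := by
    ext b
    simp only [Set.mem_iUnion, Finset.mem_filter, exists_prop]
    constructor
    · intro hb
      obtain ⟨𝒰, hS, hZW⟩ := hcover b
      exact ⟨𝒰, ⟨hS, fun c hc => (H 𝒰 c hc.1 hc.2).1 ((H 𝒰 b hZW.1 hZW.2).2 hb)⟩, hZW⟩
    · rintro ⟨𝒰, ⟨-, h⟩, hb⟩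
      exact h hb
  rw [heq]
  exact isConstructibleIn_of_finset _ Z W hZ fun 𝒰 => hclosed _

end Definability

end

/-- Prolongation admissibility is definable in families: for a family of Zariski
closed sets `V_b ⊆ K^{n(h+1)}` cut out by polynomials `f i` in the parameters
`u : Fin q` and the variables `x_i^{(j)}`, the set of parameters `b` with
`V_b = B_h(V_b)` (i.e. `V_b` equals the Zariski closure of its differential
points) is a differentially constructible subset of `K^q`. -/
theorem prolongation_admissible_definable {K : Type u} [Field K] [CharZero K]
    (δ : K → K) (hK : DiffClosedField K δ) (n h q s : ℕ)
    (f : Fin s → MvPolynomial (Fin q ⊕ Fin n × Fin (h + 1)) K) :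
    IsConstructibleIn (kolchinTopology K δ (Fin q))
      {b : Fin q → K |
        {x : Fin n × Fin (h + 1) → K |
            ∀ i, MvPolynomial.eval (Sum.elim b x) (f i) = 0} =
          @closure _ (zariskiTopology K (Fin n × Fin (h + 1)))
            ({x : Fin n × Fin (h + 1) → K |
                ∀ i, MvPolynomial.eval (Sum.elim b x) (f i) = 0} ∩
              Set.range (nablaMap δ n h))} :=
  isConstructibleIn_admissibleSet hK f
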